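/- Let a, b be positive real numbers with a ≠ b, let k ≥ 0 be an integer, and set θ = 2π/3. Then the Cauchy principal value lim_{ε→0⁺} [ ∫₀^{a−ε} + ∫_{a+ε}^∞ ] of t (t+a) (log t)^k / ((t³ − a³)(t² + b t + b²)) dt equals (θ^{k+1}/(3(a² + a b + b²))) · [ −R_k(log a / θ) + 3 R_k(log b / θ) + Y_k(log a / θ) ] + (θ^{k+1}(a+b)/(√3 (a³ − b³))) · [ S_k(log a / θ) − S_k(log b / θ) ]. -/

import Mathlib

open Finset

/-- Non-recursive part of `Rpoly`. -/
noncomputable def GR (k : ℕ) : Polynomial ℝ :=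
  Polynomial.C ((1 : ℝ) / (2 * (k + 1))) *
    ∑ j ∈ (Finset.range (k + 2)).filter (fun j => Even j),
      Polynomial.C ((-1 : ℝ) ^ (j / 2) * ((k + 1).choose j : ℝ) * ((2 : ℝ) ^ j + 1)) *
        Polynomial.X ^ (k + 1 - j)

noncomputable def GS (k : ℕ) : Polynomial ℝ :=
  Polynomial.C ((1 : ℝ) / (2 * (k + 1))) *
    ∑ j ∈ (Finset.range (k + 2)).filter (fun j => Odd j),
      Polynomial.C ((-1 : ℝ) ^ ((j + 1) / 2) * ((k + 1).choose j : ℝ) * ((2 : ℝ) ^ j - 1)) *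
        Polynomial.X ^ (k + 1 - j)

noncomputable def GP (k : ℕ) : Polynomial ℝ :=
  Polynomial.C ((1 : ℝ) / (2 * (k + 1))) *
    ∑ j ∈ (Finset.range (k + 2)).filter (fun j => Even j),
      Polynomial.C ((-1 : ℝ) ^ (j / 2) * ((k + 1).choose j : ℝ) * ((5 : ℝ) ^ j + 1)) *
        Polynomial.X ^ (k + 1 - j)

noncomputable def GQ (k : ℕ) : Polynomial ℝ :=
  Polynomial.C ((1 : ℝ) / (2 * (k + 1))) *
    ∑ j ∈ (Finset.range (k + 2)).filter (fun j => Odd j),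
      Polynomial.C ((-1 : ℝ) ^ ((j - 1) / 2) * ((k + 1).choose j : ℝ) * ((5 : ℝ) ^ j - 1)) *
        Polynomial.X ^ (k + 1 - j)

noncomputable def GY (k : ℕ) : Polynomial ℝ :=
  Polynomial.C (-((1 : ℝ) / (k + 1))) *
    (Polynomial.X ^ (k + 1) +
      ∑ j ∈ (Finset.range (k + 2)).filter (fun j => Even j),
        Polynomial.C ((-1 : ℝ) ^ (j / 2) * ((k + 1).choose j : ℝ) * ((3 : ℝ) ^ j)) *
          Polynomial.X ^ (k + 1 - j))

noncomputable def GZ (k : ℕ) : Polynomial ℝ :=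
  Polynomial.C (-((2 : ℝ) / (k + 1))) *
    ∑ j ∈ (Finset.range (k + 2)).filter (fun j => Even j),
      Polynomial.C ((-1 : ℝ) ^ (j / 2) * ((k + 1).choose j : ℝ) * ((3 : ℝ) ^ j)) *
        Polynomial.X ^ (k + 1 - j)

/-- The common recursion: `F k = (1/(k+1)) ∑_{3 ≤ j ≤ k+1, j odd}
(−1)^{(j+1)/2} C(k+1,j) m^{j−1} F_{k+1−j} + G k`. -/
noncomputable def recFam (m : ℝ) (G : ℕ → Polynomial ℝ) : ℕ → Polynomial ℝ := fun k =>
  Nat.strongRecOn k fun k ih =>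
    Polynomial.C ((1 : ℝ) / (k + 1)) *
      (∑ j ∈ ((Finset.range (k + 2)).filter (fun j => Odd j ∧ 3 ≤ j)).attach,
        Polynomial.C ((-1 : ℝ) ^ ((j.1 + 1) / 2) * ((k + 1).choose j.1 : ℝ) * m ^ (j.1 - 1)) *
          ih (k + 1 - j.1) (by
            have hj := j.2
            simp only [Finset.mem_filter, Finset.mem_range] at hj
            omega))
    + G k

noncomputable def Rpoly : ℕ → Polynomial ℝ := recFam 3 GR
noncomputable def Spoly : ℕ → Polynomial ℝ := recFam 3 GS
noncomputable def Ppoly : ℕ → Polynomial ℝ := recFam 6 GP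
noncomputable def Qpoly : ℕ → Polynomial ℝ := recFam 6 GQ
noncomputable def Ypoly : ℕ → Polynomial ℝ := recFam 3 GY
noncomputable def Zpoly : ℕ → Polynomial ℝ := recFam 6 GZ

open MeasureTheory

/-- The interval part of the Mellin-type integral `∫ (x^(σ-1) - x^(τ-1)) / (1 - x)`. -/
lemma hasSum_integral_Ioo_rpow_sub_div_of_le {σ τ : ℝ} (hσ : 0 < σ) (h : σ ≤ τ) :
    IntegrableOn (fun x : ℝ => (x ^ (σ - 1) - x ^ (τ - 1)) / (1 - x)) (Set.Ioo 0 1) ∧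
    HasSum (fun n : ℕ => 1 / (n + σ) - 1 / (n + τ))
      (∫ x in Set.Ioo (0 : ℝ) 1, (x ^ (σ - 1) - x ^ (τ - 1)) / (1 - x)) := by
  have hτ : 0 < τ := hσ.trans_le h
  have hInt : ∀ r : ℝ, 0 < r → IntegrableOn (fun x : ℝ => x ^ (r - 1)) (Set.Ioo 0 1) := by
    intro r hr
    have := (intervalIntegral.intervalIntegrable_rpow' (a := 0) (b := 1)
      (r := r - 1) (by linarith))
    rw [intervalIntegrable_iff_integrableOn_Ioo_of_le zero_le_one] at this
    exact this
  have hval : ∀ r : ℝ, 0 < r → ∫ x in Set.Ioo (0 : ℝ) 1, x ^ (r - 1) = 1 / r := by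
    intro r hr
    rw [← integral_Ioc_eq_integral_Ioo, ← intervalIntegral.integral_of_le zero_le_one,
      integral_rpow (Or.inl (by linarith))]
    simp [Real.zero_rpow hr.ne']
  constructor
  · obtain ⟨m, hm⟩ := exists_nat_ge (τ - σ)
    refine Integrable.mono' ((hInt σ hσ).const_mul (m : ℝ)) ?_ ?_
    · exact (by fun_prop : Measurable fun x : ℝ =>
        (x ^ (σ - 1) - x ^ (τ - 1)) / (1 - x)).aestronglyMeasurable
    · refine (ae_restrict_iff' measurableSet_Ioo).2 (ae_of_all _ fun x hx => ?_)
      have h1 : x ^ (τ - 1) = x ^ (σ - 1) * x ^ (τ - σ) := by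
        rw [← Real.rpow_add hx.1]; congr 1; ring
      have h2 : (x : ℝ) ^ m ≤ x ^ (τ - σ) := by
        rw [← Real.rpow_natCast]
        exact Real.rpow_le_rpow_of_exponent_ge hx.1 hx.2.le hm
      have h3 : 1 + m * (x - 1) ≤ x ^ m := by
        have := one_add_mul_le_pow (a := x - 1) (by linarith [hx.1]) m
        simpa using this
      have h4 : x ^ (τ - σ) ≤ 1 := Real.rpow_le_one hx.1.le hx.2.le (by linarith)
      have h5 : 0 < x ^ (σ - 1) := Real.rpow_pos_of_pos hx.1 _
      have h6 : 0 < 1 - x := by linarith [hx.2]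
      rw [h1, Real.norm_of_nonneg (div_nonneg (by nlinarith) h6.le), div_le_iff₀ h6]
      nlinarith
  · have hpt : ∀ n : ℕ, ∀ x ∈ Set.Ioo (0 : ℝ) 1, x ^ (n + τ - 1) ≤ x ^ (n + σ - 1) := by
      intro n x hx
      exact Real.rpow_le_rpow_of_exponent_ge hx.1 hx.2.le (by linarith)
    have hI : ∀ n : ℕ, Integrable (fun x : ℝ => x ^ (n + σ - 1) - x ^ (n + τ - 1))
        (volume.restrict (Set.Ioo 0 1)) := fun n =>
      (hInt _ (by positivity)).sub (hInt _ (by positivity))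
    have hV : ∀ n : ℕ, ∫ x in Set.Ioo (0 : ℝ) 1, (x ^ (n + σ - 1) - x ^ (n + τ - 1)) =
        1 / (n + σ) - 1 / (n + τ) := by
      intro n
      rw [integral_sub (hInt _ (by positivity)) (hInt _ (by positivity)),
        hval _ (by positivity), hval _ (by positivity)]
    have hN : ∀ n : ℕ, ∫ x in Set.Ioo (0 : ℝ) 1, ‖x ^ (n + σ - 1) - x ^ (n + τ - 1)‖ =
        1 / (n + σ) - 1 / (n + τ) := by
      intro n
      rw [← hV n]
      refine setIntegral_congr_fun measurableSet_Ioo fun x hx => ?_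
      exact Real.norm_of_nonneg (sub_nonneg.2 (hpt n x hx))
    have hsum : Summable fun n : ℕ => 1 / (n + σ) - 1 / (n + τ) := by
      have h2 : Summable fun n : ℕ => (τ - σ) * (1 / |(n : ℝ) + σ| ^ (2 : ℝ)) :=
        ((Real.summable_one_div_nat_add_rpow σ 2).2 (by norm_num)).mul_left _
      refine Summable.of_nonneg_of_le (fun n => ?_) (fun n => ?_) h2
      · exact sub_nonneg.2 (one_div_le_one_div_of_le (by positivity) (by linarith))
      · have p1 : 0 < (n : ℝ) + σ := by positivity
        have p2 : 0 < (n : ℝ) + τ := by positivity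
        rw [abs_of_pos p1, div_sub_div _ _ p1.ne' p2.ne', mul_one_div]
        have p3 : 0 < ((n : ℝ) + σ) ^ (2 : ℝ) := by positivity
        refine div_le_div₀ (by linarith) (by linarith) p3 ?_
        rw [Real.rpow_two]
        nlinarith
    have key := hasSum_integral_of_summable_integral_norm hI (by simpa only [hN] using hsum)
    simp only [hV] at key
    have heq : ∫ x in Set.Ioo (0 : ℝ) 1, ∑' n : ℕ, (x ^ (n + σ - 1) - x ^ (n + τ - 1)) =
        ∫ x in Set.Ioo (0 : ℝ) 1, (x ^ (σ - 1) - x ^ (τ - 1)) / (1 - x) := by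
      refine setIntegral_congr_fun measurableSet_Ioo fun x hx => ?_
      have : ∀ n : ℕ, x ^ (n + σ - 1) - x ^ (n + τ - 1)
          = x ^ n * (x ^ (σ - 1) - x ^ (τ - 1)) := by
        intro n
        rw [add_sub_assoc, add_sub_assoc, Real.rpow_add hx.1, Real.rpow_add hx.1,
          Real.rpow_natCast]
        ring
      simp only [this]
      rw [tsum_mul_right, tsum_geometric_of_lt_one hx.1.le hx.2]
      ring
    rwa [heq] at key

lemma hasSum_integral_Ioo_rpow_sub_div {σ τ : ℝ} (hσ : 0 < σ) (hτ : 0 < τ) :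
    IntegrableOn (fun x : ℝ => (x ^ (σ - 1) - x ^ (τ - 1)) / (1 - x)) (Set.Ioo 0 1) ∧
    HasSum (fun n : ℕ => 1 / (n + σ) - 1 / (n + τ))
      (∫ x in Set.Ioo (0 : ℝ) 1, (x ^ (σ - 1) - x ^ (τ - 1)) / (1 - x)) := by
  rcases le_total σ τ with h | h
  · exact hasSum_integral_Ioo_rpow_sub_div_of_le hσ h
  · obtain ⟨h1, h2⟩ := hasSum_integral_Ioo_rpow_sub_div_of_le hτ h
    have e : (fun x : ℝ => (x ^ (σ - 1) - x ^ (τ - 1)) / (1 - x)) =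
        fun x => -((x ^ (τ - 1) - x ^ (σ - 1)) / (1 - x)) := by
      ext x; rw [← neg_div, neg_sub]
    rw [e]
    refine ⟨h1.neg, ?_⟩
    rw [integral_neg]
    convert! h2.neg using 2
    ring

open Filter Topology in
lemma tendsto_sum_one_div_sub_one_div_cot {σ : ℝ} (h0 : 0 < σ) (h1 : σ < 1) :
    Tendsto (fun N : ℕ => ∑ n ∈ range N, (1 / ((n : ℝ) + σ) - 1 / (n + (1 - σ)))) atTop
      (𝓝 (Real.pi * Real.cot (Real.pi * σ))) := by
  have hz : (σ : ℂ) ∈ Complex.integerComplement := by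
    rintro ⟨n, hn⟩
    have : (n : ℝ) = σ := by exact_mod_cast hn
    have l1 : (0 : ℝ) < n := by linarith
    have l2 : (n : ℝ) < 1 := by linarith
    have l3 : 0 < n := by exact_mod_cast l1
    have l4 : n < 1 := by exact_mod_cast l2
    omega
  have hs := (summable_cotTerm hz).hasSum.tendsto_sum_nat
  rw [← cot_series_rep' hz] at hs
  have hs' : Tendsto (fun N : ℕ => ∑ n ∈ range N,
      (1 / (σ - ((n : ℝ) + 1)) + 1 / (σ + (n + 1)))) atTop
      (𝓝 (Real.pi * Real.cot (Real.pi * σ) - 1 / σ)) := by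
    convert (Complex.continuous_re.tendsto _).comp hs using 2
    · rw [Function.comp_apply, ← Complex.ofReal_re (∑ n ∈ range _, _)]
      push_cast
      rfl
    · rw [← Complex.ofReal_re (_ - _)]
      push_cast
      rfl
  have hlast : Tendsto (fun N : ℕ => 1 / ((N : ℝ) + (1 - σ))) atTop (𝓝 0) := by
    simp only [one_div]
    exact (tendsto_atTop_add_const_right _ _ tendsto_natCast_atTop_atTop).inv_tendsto_atTop
  have heq : ∀ N : ℕ, ∑ n ∈ range (N + 1), (1 / ((n : ℝ) + σ) - 1 / (n + (1 - σ))) =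
      1 / σ + ∑ n ∈ range N, (1 / (σ - ((n : ℝ) + 1)) + 1 / (σ + (n + 1)))
        - 1 / ((N : ℝ) + (1 - σ)) := by
    intro N
    induction N with
    | zero => simp
    | succ N ih =>
      rw [sum_range_succ, ih, sum_range_succ]
      have : (N : ℝ) + (1 - σ) ≠ 0 := by
        have : (0 : ℝ) ≤ N := N.cast_nonneg
        linarith
      have e : 1 / (σ - ((N : ℝ) + 1)) = - (1 / ((N : ℝ) + (1 - σ))) := by
        rw [← div_neg]; congr 1; ring
      rw [e]
      push_cast
      ring
  rw [← tendsto_add_atTop_iff_nat 1]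
  simp only [heq]
  have := (hs'.const_add (1 / σ)).sub hlast
  convert this using 2
  ring

lemma integral_Ioi_rpow_sub_div {σ τ : ℝ} (hσ0 : 0 < σ) (hσ1 : σ < 1) (hτ0 : 0 < τ)
    (hτ1 : τ < 1) :
    IntegrableOn (fun x : ℝ => (x ^ (σ - 1) - x ^ (τ - 1)) / (1 - x)) (Set.Ioi 0) ∧
    ∫ x in Set.Ioi (0 : ℝ), (x ^ (σ - 1) - x ^ (τ - 1)) / (1 - x) =
      Real.pi * Real.cot (Real.pi * σ) - Real.pi * Real.cot (Real.pi * τ) := by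
  set K : ℝ → ℝ := fun x => (x ^ (σ - 1) - x ^ (τ - 1)) / (1 - x) with hK
  obtain ⟨i1, s1⟩ := hasSum_integral_Ioo_rpow_sub_div hσ0 hτ0
  obtain ⟨i2, s2⟩ := hasSum_integral_Ioo_rpow_sub_div (sub_pos.2 hτ1) (sub_pos.2 hσ1)
  set K' : ℝ → ℝ := fun x => (x ^ (1 - τ - 1) - x ^ (1 - σ - 1)) / (1 - x) with hK'
  have hcomp : Set.EqOn (fun x : ℝ => (|(-1 : ℝ)| * x ^ ((-1 : ℝ) - 1)) •
      (Set.Ioi 1).indicator K (x ^ (-1 : ℝ))) ((Set.Ioo 0 1).indicator K') (Set.Ioi 0) := by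
    intro x hx
    have hx : 0 < x := hx
    have e1 : x ^ (-1 : ℝ) = x⁻¹ := Real.rpow_neg_one x
    by_cases h : x < 1
    · rw [Set.indicator_of_mem (show x ∈ Set.Ioo 0 1 from ⟨hx, h⟩)]
      simp only [e1]
      rw [Set.indicator_of_mem (show x⁻¹ ∈ Set.Ioi 1 from (one_lt_inv₀ hx).2 h)]
      simp only [hK, hK', abs_neg, abs_one, one_mul, smul_eq_mul, Real.inv_rpow hx.le]
      rw [← Real.rpow_neg hx.le, ← Real.rpow_neg hx.le]
      have h1 : 1 - x⁻¹ ≠ 0 := by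
        have := (one_lt_inv₀ hx).2 h
        linarith
      have h2 : 1 - x ≠ 0 := by linarith
      have e2 : 1 - x⁻¹ = - (1 - x) * x ^ (-1 : ℝ) := by
        rw [e1]; field_simp; ring
      rw [e2, mul_div_assoc', div_eq_div_iff (by rw [← e2]; exact h1) h2]
      have a1 : x ^ ((-1 : ℝ) - 1) * x ^ (-(σ - 1)) = x ^ (1 - σ - 1) * x ^ (-1 : ℝ) := by
        rw [← Real.rpow_add hx, ← Real.rpow_add hx]; congr 1; ring
      have a2 : x ^ ((-1 : ℝ) - 1) * x ^ (-(τ - 1)) = x ^ (1 - τ - 1) * x ^ (-1 : ℝ) := by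
        rw [← Real.rpow_add hx, ← Real.rpow_add hx]; congr 1; ring
      linear_combination (1 - x) * a1 - (1 - x) * a2
    · rw [Set.indicator_of_notMem (fun hh => h hh.2)]
      simp only [e1]
      rw [Set.indicator_of_notMem (fun hh : x⁻¹ ∈ Set.Ioi 1 => h ((one_lt_inv₀ hx).1 hh)),
        smul_zero]
  have j2 : IntegrableOn ((Set.Ioi 1).indicator K) (Set.Ioi 0) := by
    rw [← integrableOn_Ioi_comp_rpow_iff _ (by norm_num : (-1 : ℝ) ≠ 0)]
    refine IntegrableOn.congr_fun ?_ hcomp.symm measurableSet_Ioi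
    exact ((integrable_indicator_iff measurableSet_Ioo).2 i2).integrableOn
  have v2 : ∫ x in Set.Ioi 1, K x = ∫ x in Set.Ioo 0 1, K' x := by
    have := integral_comp_rpow_Ioi ((Set.Ioi 1).indicator K) (by norm_num : (-1 : ℝ) ≠ 0)
    rw [setIntegral_congr_fun measurableSet_Ioi hcomp, setIntegral_indicator measurableSet_Ioo,
      setIntegral_indicator measurableSet_Ioi] at this
    rw [Set.inter_eq_right.2 (fun x hx => hx.1), Set.inter_eq_right.2
      (Set.Ioi_subset_Ioi zero_le_one)] at this
    exact this.symm
  have j2' : IntegrableOn K (Set.Ioi 1) := by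
    rw [IntegrableOn, integrable_indicator_iff measurableSet_Ioi, IntegrableOn,
      Measure.restrict_restrict measurableSet_Ioi,
      Set.inter_eq_left.2 (Set.Ioi_subset_Ioi zero_le_one)] at j2
    exact j2
  have i1' : IntegrableOn K (Set.Ioc 0 1) := (integrableOn_Ioc_iff_integrableOn_Ioo (by simp)).2 i1
  have hU : Set.Ioc (0 : ℝ) 1 ∪ Set.Ioi 1 = Set.Ioi 0 := Set.Ioc_union_Ioi_eq_Ioi zero_le_one
  refine ⟨hU ▸ i1'.union j2', ?_⟩
  rw [← hU, setIntegral_union (Set.Ioc_disjoint_Ioi le_rfl) measurableSet_Ioi i1' j2', v2,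
    integral_Ioc_eq_integral_Ioo]
  refine tendsto_nhds_unique (s1.add s2).tendsto_sum_nat ?_
  have := (tendsto_sum_one_div_sub_one_div_cot hσ0 hσ1).sub
    (tendsto_sum_one_div_sub_one_div_cot hτ0 hτ1)
  refine this.congr fun N => ?_
  rw [← sum_sub_distrib]
  exact sum_congr rfl fun n _ => by ring

lemma integral_Ioi_rpow_sub_div_cube_sub_cube {c r : ℝ} (hc : 0 < c) (hr0 : -1 < r) (hr1 : r < 2) :
    IntegrableOn (fun t : ℝ => (t ^ r - c ^ (r - 1 / 2) * t ^ (1 / 2 : ℝ)) / (t ^ 3 - c ^ 3))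
      (Set.Ioi 0) ∧
    ∫ t in Set.Ioi (0 : ℝ), (t ^ r - c ^ (r - 1 / 2) * t ^ (1 / 2 : ℝ)) / (t ^ 3 - c ^ 3) =
      -(Real.pi / 3) * c ^ (r - 2) * Real.cot (Real.pi * ((r + 1) / 3)) := by
  obtain ⟨hi, hv⟩ := integral_Ioi_rpow_sub_div (σ := (r + 1) / 3) (τ := 1 / 2)
    (by linarith) (by linarith) (by norm_num) (by norm_num)
  have hcot : Real.cot (Real.pi * (1 / 2)) = 0 := by
    rw [Real.cot_eq_cos_div_sin, mul_one_div, Real.cos_pi_div_two, zero_div]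
  rw [hcot, mul_zero, sub_zero] at hv
  set K : ℝ → ℝ := fun x => (x ^ ((r + 1) / 3 - 1) - x ^ ((1 : ℝ) / 2 - 1)) / (1 - x) with hK
  set H : ℝ → ℝ := fun y => (3 * y ^ ((3 : ℝ) - 1)) • K (y ^ (3 : ℝ)) with hH
  have hHi : IntegrableOn H (Set.Ioi 0) := by
    have := (integrableOn_Ioi_comp_rpow_iff K (by norm_num : (3 : ℝ) ≠ 0)).2 hi
    simpa [hH] using this
  have hHv : ∫ y in Set.Ioi (0 : ℝ), H y = Real.pi * Real.cot (Real.pi * ((r + 1) / 3)) := by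
    rw [← hv]
    exact integral_comp_rpow_Ioi_of_pos (by norm_num : (0 : ℝ) < 3)
  have hc' : 0 < c⁻¹ := inv_pos.2 hc
  have hHi' : IntegrableOn (fun t => H (c⁻¹ * t)) (Set.Ioi 0) := by
    rw [integrableOn_Ioi_comp_mul_left_iff H 0 hc', mul_zero]
    exact hHi
  have hHv' : ∫ t in Set.Ioi (0 : ℝ), H (c⁻¹ * t) =
      c * (Real.pi * Real.cot (Real.pi * ((r + 1) / 3))) := by
    rw [integral_comp_mul_left_Ioi H 0 hc', mul_zero, hHv, inv_inv, smul_eq_mul]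
  have heq : Set.EqOn (fun t : ℝ => -(1 / 3) * c ^ (r - 3) * H (c⁻¹ * t))
      (fun t : ℝ => (t ^ r - c ^ (r - 1 / 2) * t ^ (1 / 2 : ℝ)) / (t ^ 3 - c ^ 3))
      (Set.Ioi 0) := by
    intro t ht
    have ht : 0 < t := ht
    obtain ⟨y, rfl⟩ : ∃ y, t = c * y := ⟨c⁻¹ * t, by field_simp⟩
    have hy : 0 < y := pos_of_mul_pos_right ht hc.le
    simp only [hH, hK, smul_eq_mul, inv_mul_cancel_left₀ hc.ne']
    rw [← Real.rpow_mul hy.le, ← Real.rpow_mul hy.le, Real.mul_rpow hc.le hy.le,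
      Real.mul_rpow hc.le hy.le, mul_pos_iff_of_pos_left hc] at *
    have e3 : y ^ (3 : ℝ) = y ^ 3 := by exact_mod_cast Real.rpow_natCast y 3
    have c1 : c ^ r = c ^ (r - 3) * c ^ 3 := by
      rw [← Real.rpow_natCast, ← Real.rpow_add hc]; congr 1; push_cast; ring
    have c2 : c ^ (r - 1 / 2) * c ^ (1 / 2 : ℝ) = c ^ (r - 3) * c ^ 3 := by
      rw [← Real.rpow_natCast, ← Real.rpow_add hc, ← Real.rpow_add hc]; congr 1; push_cast; ring
    have y1 : y ^ ((3 : ℝ) - 1) * y ^ (3 * ((r + 1) / 3 - 1)) = y ^ r := by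
      rw [← Real.rpow_add hy]; congr 1; ring
    have y2 : y ^ ((3 : ℝ) - 1) * y ^ ((3 : ℝ) * (1 / 2 - 1)) = y ^ (1 / 2 : ℝ) := by
      rw [← Real.rpow_add hy]; congr 1; ring
    have hc3 : c ^ 3 ≠ 0 := by positivity
    rw [← mul_assoc (c ^ (r - 1 / 2)), c2, c1, e3]
    have : (c ^ (r - 3) * c ^ 3 * y ^ r - c ^ (r - 3) * c ^ 3 * y ^ (1 / 2 : ℝ)) /
        ((c * y) ^ 3 - c ^ 3) = c ^ (r - 3) * (-(y ^ r - y ^ (1 / 2 : ℝ)) / (1 - y ^ 3)) := by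
      rw [show (c * y) ^ 3 - c ^ 3 = c ^ 3 * (-(1 - y ^ 3)) by ring,
        show c ^ (r - 3) * c ^ 3 * y ^ r - c ^ (r - 3) * c ^ 3 * y ^ (1 / 2 : ℝ) =
          c ^ 3 * (c ^ (r - 3) * (y ^ r - y ^ (1 / 2 : ℝ))) by ring,
        mul_div_mul_left _ _ hc3, div_neg, neg_div, mul_div_assoc, mul_neg]
    rw [this, ← y1, ← y2]
    ring
  refine ⟨IntegrableOn.congr_fun (hHi'.const_mul _) heq measurableSet_Ioi, ?_⟩
  rw [← setIntegral_congr_fun measurableSet_Ioi heq, integral_const_mul, hHv']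
  have : c ^ (r - 2) = c ^ (r - 3) * c := by
    rw [← Real.rpow_add_one hc.ne']; congr 1; ring
  rw [this]
  ring

/-- The rational part of the integrand. -/
noncomputable def ratFun (a b t : ℝ) : ℝ :=
  t * (t + a) / ((t ^ 3 - a ^ 3) * (t ^ 2 + b * t + b ^ 2))

/-- A function with the same residue at `a` as `ratFun a b` whose principal value vanishes. -/
noncomputable def poleFun (a b t : ℝ) : ℝ :=
  2 / (a ^ 2 + a * b + b ^ 2) * a ^ (3 / 2 : ℝ) * t ^ (1 / 2 : ℝ) / (t ^ 3 - a ^ 3)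

/-- The value of `sin (2πs)` times the regularized Mellin transform of `ratFun a b`. -/
noncomputable def mellinNum (a b s : ℝ) : ℝ :=
  2 * Real.pi / 3 / (3 * (a ^ 2 + a * b + b ^ 2)) *
      (-(3 / 2 * (a ^ s * (Real.cos (2 * (2 * Real.pi / 3) * s) +
            Real.cos (2 * Real.pi / 3 * s))))
        + 3 * (3 / 2 * (b ^ s * (Real.cos (2 * (2 * Real.pi / 3) * s) +
            Real.cos (2 * Real.pi / 3 * s))))
        - 3 * (a ^ s * (1 + Real.cos (3 * (2 * Real.pi / 3) * s))))
    - 2 * Real.pi / 3 * (a + b) / (Real.sqrt 3 * (a ^ 3 - b ^ 3)) * (3 / 2) *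
      ((a ^ s - b ^ s) * (Real.sin (2 * (2 * Real.pi / 3) * s) -
        Real.sin (2 * Real.pi / 3 * s)))

lemma cot_trig_identities {φ : ℝ} (h0 : Real.sin φ ≠ 0) (h1 : Real.sin (φ + Real.pi / 3) ≠ 0)
    (h2 : Real.sin (φ + 2 * Real.pi / 3) ≠ 0) :
    Real.sin (6 * φ) * (2 * Real.cot (φ + Real.pi) - Real.cot (φ + Real.pi / 3)
        - Real.cot (φ + 2 * Real.pi / 3)) = 6 * (Real.cos (4 * φ) + Real.cos (2 * φ)) ∧
    Real.sin (6 * φ) * (Real.cot (φ + Real.pi) + Real.cot (φ + Real.pi / 3)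
        + Real.cot (φ + 2 * Real.pi / 3)) = 3 * (1 + Real.cos (6 * φ)) ∧
    Real.sin (6 * φ) * (Real.cot (φ + Real.pi / 3) - Real.cot (φ + 2 * Real.pi / 3)) =
      2 * Real.sqrt 3 * (Real.sin (4 * φ) - Real.sin (2 * φ)) := by
  have hq : Real.sqrt 3 ^ 2 = 3 := Real.sq_sqrt (by norm_num)
  have hsc : Real.sin φ ^ 2 + Real.cos φ ^ 2 = 1 := Real.sin_sq_add_cos_sq φ
  have c2 : Real.cos (2 * φ) = 2 * Real.cos φ ^ 2 - 1 := Real.cos_two_mul φ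
  have s2 : Real.sin (2 * φ) = 2 * Real.sin φ * Real.cos φ := Real.sin_two_mul φ
  have c4 : Real.cos (4 * φ) = 2 * Real.cos (2 * φ) ^ 2 - 1 := by
    rw [← Real.cos_two_mul]; ring_nf
  have s4 : Real.sin (4 * φ) = 2 * Real.sin (2 * φ) * Real.cos (2 * φ) := by
    rw [← Real.sin_two_mul]; ring_nf
  have c6 : Real.cos (6 * φ) = 2 * Real.cos (3 * φ) ^ 2 - 1 := by
    rw [← Real.cos_two_mul]; ring_nf
  have s6 : Real.sin (6 * φ) = 2 * Real.sin (3 * φ) * Real.cos (3 * φ) := by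
    rw [← Real.sin_two_mul]; ring_nf
  have c3 := Real.cos_three_mul φ
  have s3 := Real.sin_three_mul φ
  have cp : Real.cos (2 * Real.pi / 3) = -(1 / 2) := by
    rw [show 2 * Real.pi / 3 = Real.pi - Real.pi / 3 by ring, Real.cos_pi_sub,
      Real.cos_pi_div_three]
  have sp : Real.sin (2 * Real.pi / 3) = Real.sqrt 3 / 2 := by
    rw [show 2 * Real.pi / 3 = Real.pi - Real.pi / 3 by ring, Real.sin_pi_sub,
      Real.sin_pi_div_three]
  simp only [Real.cot_eq_cos_div_sin]
  rw [Real.sin_add] at h1 h2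
  rw [cp, sp] at h2
  rw [Real.sin_pi_div_three, Real.cos_pi_div_three] at h1
  simp only [Real.sin_add, Real.cos_add, Real.cos_pi, Real.sin_pi, cp, sp,
    Real.sin_pi_div_three, Real.cos_pi_div_three]
  rw [c4, s4, c6, s6, c3, s3, c2, s2]
  generalize Real.sin φ = S at *
  generalize Real.cos φ = C at *
  generalize Real.sqrt 3 = q at *
  have hS : S ^ 2 = 1 - C ^ 2 := by linarith
  have d0 : S * (-1) + C * 0 ≠ 0 := by simpa using h0
  have t0 : (3 * S - 4 * S ^ 3) * ((C * (-1) - S * 0) / (S * (-1) + C * 0))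
      = (4 * C ^ 2 - 1) * C := by
    have e : (C * (-1) - S * 0) / (S * (-1) + C * 0) = C / S := by
      rw [mul_zero, mul_zero, sub_zero, add_zero, mul_neg_one, mul_neg_one, neg_div_neg_eq]
    rw [e]
    field_simp
    linear_combination (-4 * C) * hsc
  have t1 : (3 * S - 4 * S ^ 3) * ((C * (1 / 2) - S * (q / 2)) / (S * (1 / 2) + C * (q / 2)))
      = 4 * S * (C * (q / 2) - S * (1 / 2)) * (C * (1 / 2) - S * (q / 2)) := by
    rw [mul_div_assoc', div_eq_iff h1]
    grind
  have t2 : (3 * S - 4 * S ^ 3) * ((C * -(1 / 2) - S * (q / 2)) / (S * -(1 / 2) + C * (q / 2)))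
      = 4 * S * (C * (q / 2) + S * (1 / 2)) * (C * -(1 / 2) - S * (q / 2)) := by
    rw [mul_div_assoc', div_eq_iff h2]
    grind
  generalize (C * (-1) - S * 0) / (S * (-1) + C * 0) = X0 at *
  generalize (C * (1 / 2) - S * (q / 2)) / (S * (1 / 2) + C * (q / 2)) = X1 at *
  generalize (C * -(1 / 2) - S * (q / 2)) / (S * -(1 / 2) + C * (q / 2)) = X2 at *
  clear h0 h1 h2 d0 c2 s2 c4 s4 c6 s6 c3 s3 cp sp
  refine ⟨?_, ?_, ?_⟩
  · have : 2 * (3 * S - 4 * S ^ 3) * (4 * C ^ 3 - 3 * C) * (2 * X0 - X1 - X2) =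
      2 * (4 * C ^ 3 - 3 * C) *
        (2 * ((4 * C ^ 2 - 1) * C) - 4 * S * (C * (q / 2) - S * (1 / 2)) *
          (C * (1 / 2) - S * (q / 2))
        - 4 * S * (C * (q / 2) + S * (1 / 2)) * (C * -(1 / 2) - S * (q / 2))) := by
      linear_combination 2 * (4 * C ^ 3 - 3 * C) * (2 * t0 - t1 - t2)
    rw [this]; clear this t0 t1 t2; grind
  · have : 2 * (3 * S - 4 * S ^ 3) * (4 * C ^ 3 - 3 * C) * (X0 + X1 + X2) =
      2 * (4 * C ^ 3 - 3 * C) *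
        (((4 * C ^ 2 - 1) * C) + 4 * S * (C * (q / 2) - S * (1 / 2)) *
          (C * (1 / 2) - S * (q / 2))
        + 4 * S * (C * (q / 2) + S * (1 / 2)) * (C * -(1 / 2) - S * (q / 2))) := by
      linear_combination 2 * (4 * C ^ 3 - 3 * C) * (t0 + t1 + t2)
    rw [this]; clear this t0 t1 t2; grind
  · have : 2 * (3 * S - 4 * S ^ 3) * (4 * C ^ 3 - 3 * C) * (X1 - X2) =
      2 * (4 * C ^ 3 - 3 * C) * (4 * S * (C * (q / 2) - S * (1 / 2)) *
          (C * (1 / 2) - S * (q / 2))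
        - 4 * S * (C * (q / 2) + S * (1 / 2)) * (C * -(1 / 2) - S * (q / 2))) := by
      linear_combination 2 * (4 * C ^ 3 - 3 * C) * (t1 - t2)
    rw [this]; clear this t0 t1 t2; grind


lemma integral_Ioi_rpow_mul_quadratic_div {c s : ℝ} (hc : 0 < c) (hs1 : -1 < s) (hs0 : s < 0)
    (q₀ q₁ q₂ : ℝ) :
    IntegrableOn (fun t : ℝ => (t ^ s * (q₂ * t ^ 2 + q₁ * c * t + q₀ * c ^ 2)
        - c ^ s * (q₂ + q₁ + q₀) * c ^ (3 / 2 : ℝ) * t ^ (1 / 2 : ℝ)) / (t ^ 3 - c ^ 3))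
      (Set.Ioi 0) ∧
    ∫ t in Set.Ioi (0 : ℝ), (t ^ s * (q₂ * t ^ 2 + q₁ * c * t + q₀ * c ^ 2)
        - c ^ s * (q₂ + q₁ + q₀) * c ^ (3 / 2 : ℝ) * t ^ (1 / 2 : ℝ)) / (t ^ 3 - c ^ 3) =
      -(Real.pi / 3) * c ^ s * (q₂ * Real.cot (Real.pi * s / 3 + Real.pi)
        + q₁ * Real.cot (Real.pi * s / 3 + 2 * Real.pi / 3)
        + q₀ * Real.cot (Real.pi * s / 3 + Real.pi / 3)) := by
  obtain ⟨i0, e0⟩ := integral_Ioi_rpow_sub_div_cube_sub_cube (r := s) hc (by linarith)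
    (by linarith)
  obtain ⟨i1, e1⟩ := integral_Ioi_rpow_sub_div_cube_sub_cube (r := s + 1) hc (by linarith)
    (by linarith)
  obtain ⟨i2, e2⟩ := integral_Ioi_rpow_sub_div_cube_sub_cube (r := s + 2) hc (by linarith)
    (by linarith)
  have hI := ((i2.const_mul q₂).add (i1.const_mul (q₁ * c))).add (i0.const_mul (q₀ * c ^ 2))
  have hE : Set.EqOn
      ((fun t => q₂ * ((t ^ (s + 2) - c ^ (s + 2 - 1 / 2) * t ^ (1 / 2 : ℝ)) / (t ^ 3 - c ^ 3)))
        + (fun t => q₁ * c *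
          ((t ^ (s + 1) - c ^ (s + 1 - 1 / 2) * t ^ (1 / 2 : ℝ)) / (t ^ 3 - c ^ 3)))
        + (fun t => q₀ * c ^ 2 *
          ((t ^ s - c ^ (s - 1 / 2) * t ^ (1 / 2 : ℝ)) / (t ^ 3 - c ^ 3))))
      (fun t : ℝ => (t ^ s * (q₂ * t ^ 2 + q₁ * c * t + q₀ * c ^ 2)
        - c ^ s * (q₂ + q₁ + q₀) * c ^ (3 / 2 : ℝ) * t ^ (1 / 2 : ℝ)) / (t ^ 3 - c ^ 3))
      (Set.Ioi 0) := by
    intro t ht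
    have ht : 0 < t := ht
    have r2 : c ^ (s + 2 - 1 / 2) = c ^ s * c ^ (3 / 2 : ℝ) := by
      rw [← Real.rpow_add hc]; norm_num [add_sub_assoc]
    have r1 : c ^ (s + 1 - 1 / 2) * c = c ^ s * c ^ (3 / 2 : ℝ) := by
      rw [← Real.rpow_add hc, ← Real.rpow_add_one hc.ne']; congr 1; ring
    have r0 : c ^ (s - 1 / 2) * c ^ 2 = c ^ s * c ^ (3 / 2 : ℝ) := by
      rw [← Real.rpow_add hc, ← Real.rpow_natCast, ← Real.rpow_add hc]; congr 1; norm_num; ring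
    have t2 : t ^ (s + 2) = t ^ s * t ^ 2 := by
      rw [Real.rpow_add ht]; norm_num
    simp only [Pi.add_apply]
    rw [t2, Real.rpow_add_one ht.ne']
    simp only [mul_div_assoc', ← add_div]
    congr 1
    linear_combination (-q₂ * t ^ (1 / 2 : ℝ)) * r2 + (-q₁ * t ^ (1 / 2 : ℝ)) * r1
      + (-q₀ * t ^ (1 / 2 : ℝ)) * r0
  refine ⟨IntegrableOn.congr_fun hI hE measurableSet_Ioi, ?_⟩
  rw [← setIntegral_congr_fun measurableSet_Ioi hE, integral_add' ((i2.const_mul q₂).add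
    (i1.const_mul (q₁ * c))) (i0.const_mul (q₀ * c ^ 2)), integral_add' (i2.const_mul q₂)
    (i1.const_mul (q₁ * c)), integral_const_mul, integral_const_mul, integral_const_mul,
    e0, e1, e2]
  have p1 : c * c ^ (s + 1 - 2) = c ^ s := by
    rw [mul_comm, ← Real.rpow_add_one hc.ne']; congr 1; ring
  have p0 : c ^ 2 * c ^ (s - 2) = c ^ s := by
    rw [← Real.rpow_natCast, ← Real.rpow_add hc]; congr 1; norm_num
  rw [show s + 2 - 2 = s by ring,
    show Real.pi * ((s + 2 + 1) / 3) = Real.pi * s / 3 + Real.pi by ring,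
    show Real.pi * ((s + 1 + 1) / 3) = Real.pi * s / 3 + 2 * Real.pi / 3 by ring,
    show Real.pi * ((s + 1) / 3) = Real.pi * s / 3 + Real.pi / 3 by ring]
  linear_combination
    (-(Real.pi / 3) * q₁ * Real.cot (Real.pi * s / 3 + 2 * Real.pi / 3)) * p1 +
    (-(Real.pi / 3) * q₀ * Real.cot (Real.pi * s / 3 + Real.pi / 3)) * p0

lemma integral_Ioi_rpow_mul_ratFun_sub {a b s : ℝ} (ha : 0 < a) (hb : 0 < b) (hab : a ≠ b)
    (hs1 : -1 < s) (hs0 : s < 0) :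
    IntegrableOn (fun t : ℝ => t ^ s * ratFun a b t - a ^ s * poleFun a b t) (Set.Ioi 0) ∧
    Real.sin (2 * Real.pi * s) *
      ∫ t in Set.Ioi (0 : ℝ), (t ^ s * ratFun a b t - a ^ s * poleFun a b t) =
      mellinNum a b s := by
  have hQ : 0 < a ^ 2 + a * b + b ^ 2 := by positivity
  have hab3 : a ^ 3 - b ^ 3 ≠ 0 := by
    rw [show a ^ 3 - b ^ 3 = (a - b) * (a ^ 2 + a * b + b ^ 2) by ring]
    exact mul_ne_zero (sub_ne_zero.2 hab) hQ.ne'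
  set Q := a ^ 2 + a * b + b ^ 2 with hQdef
  obtain ⟨κ, hκ⟩ : ∃ κ, κ = (a + b) / (2 * (a ^ 3 - b ^ 3)) := ⟨_, rfl⟩
  obtain ⟨ia, ea⟩ := integral_Ioi_rpow_mul_quadratic_div ha hs1 hs0 (1 / (2 * Q) + κ)
    (1 / (2 * Q) - κ) (1 / Q)
  obtain ⟨ib, eb⟩ := integral_Ioi_rpow_mul_quadratic_div hb hs1 hs0 (1 / (2 * Q) - κ)
    (1 / (2 * Q) + κ) (-(1 / Q))
  have hne : ∀ᵐ t ∂(volume.restrict (Set.Ioi (0 : ℝ))), 0 < t ∧ t ≠ a ∧ t ≠ b := by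
    have h1 := ae_restrict_mem (μ := volume) (measurableSet_Ioi (a := (0 : ℝ)))
    have h2 : ∀ᵐ t ∂(volume.restrict (Set.Ioi (0 : ℝ))), t ≠ a := Measure.ae_ne _ a
    have h3 : ∀ᵐ t ∂(volume.restrict (Set.Ioi (0 : ℝ))), t ≠ b := Measure.ae_ne _ b
    filter_upwards [h1, h2, h3] with t h1 h2 h3 using ⟨h1, h2, h3⟩
  have hE : (fun t : ℝ =>
    (t ^ s * (1 / Q * t ^ 2 + (1 / (2 * Q) - κ) * a * t + (1 / (2 * Q) + κ) * a ^ 2)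
        - a ^ s * (1 / Q + (1 / (2 * Q) - κ) + (1 / (2 * Q) + κ)) * a ^ (3 / 2 : ℝ) *
          t ^ (1 / 2 : ℝ)) / (t ^ 3 - a ^ 3) +
    (t ^ s * (-(1 / Q) * t ^ 2 + (1 / (2 * Q) + κ) * b * t + (1 / (2 * Q) - κ) * b ^ 2)
        - b ^ s * (-(1 / Q) + (1 / (2 * Q) + κ) + (1 / (2 * Q) - κ)) * b ^ (3 / 2 : ℝ) *
          t ^ (1 / 2 : ℝ)) / (t ^ 3 - b ^ 3))
      =ᵐ[volume.restrict (Set.Ioi (0 : ℝ))]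
      fun t => t ^ s * ratFun a b t - a ^ s * poleFun a b t := by
    filter_upwards [hne] with t ht
    obtain ⟨ht, hta, htb⟩ := ht
    have hA : t ^ 3 - a ^ 3 ≠ 0 := by
      rw [show t ^ 3 - a ^ 3 = (t - a) * (t ^ 2 + t * a + a ^ 2) by ring]
      exact mul_ne_zero (sub_ne_zero.2 hta) (by positivity)
    have hB2 : t ^ 2 + b * t + b ^ 2 ≠ 0 := by positivity
    have hB : t ^ 3 - b ^ 3 = (t - b) * (t ^ 2 + b * t + b ^ 2) := by ring
    have hB1 : t - b ≠ 0 := sub_ne_zero.2 htb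
    have hpf : (1 / Q * t ^ 2 + (1 / (2 * Q) - κ) * a * t + (1 / (2 * Q) + κ) * a ^ 2) /
          (t ^ 3 - a ^ 3) +
        (-(1 / Q) * t ^ 2 + (1 / (2 * Q) + κ) * b * t + (1 / (2 * Q) - κ) * b ^ 2) /
          (t ^ 3 - b ^ 3) = ratFun a b t := by
      have hD : a - b ≠ 0 := sub_ne_zero.2 hab
      have hu : 1 / (2 * Q) = (a - b) / (2 * (a ^ 3 - b ^ 3)) := by
        rw [hQdef] at hQ ⊢
        field_simp
        ring
      have hu2 : 1 / Q = (a - b) / (a ^ 3 - b ^ 3) := by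
        rw [hQdef] at hQ ⊢
        field_simp
        ring
      rw [hu, hu2, hκ, ratFun, hB]
      field_simp
      ring
    rw [← hpf, poleFun, ← hQdef]
    field_simp
    ring
  refine ⟨(ia.add ib).congr hE, ?_⟩
  rw [← integral_congr_ae hE, integral_add ia ib, ea, eb]
  have hφ : ∀ x : ℝ, 0 < x → x < Real.pi → Real.sin x ≠ 0 := fun x h1 h2 =>
    (Real.sin_pos_of_pos_of_lt_pi h1 h2).ne'
  have hpi := Real.pi_pos
  obtain ⟨t1, t2, t3⟩ := cot_trig_identities (φ := Real.pi * s / 3)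
    (by
      rw [← neg_neg (Real.pi * s / 3), Real.sin_neg]
      exact neg_ne_zero.2 (hφ _ (by nlinarith) (by nlinarith)))
    (hφ _ (by nlinarith) (by nlinarith)) (hφ _ (by nlinarith) (by nlinarith))
  have hq : Real.sqrt 3 ^ 2 = 3 := Real.sq_sqrt (by norm_num)
  rw [mellinNum, ← hQdef, show 2 * (2 * Real.pi / 3) * s = 4 * (Real.pi * s / 3) by ring,
    show 3 * (2 * Real.pi / 3) * s = 6 * (Real.pi * s / 3) by ring,
    show 2 * Real.pi / 3 * s = 2 * (Real.pi * s / 3) by ring]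
  rw [show 2 * Real.pi * s = 6 * (Real.pi * s / 3) by ring]
  generalize Real.cot (Real.pi * s / 3 + Real.pi) = X0 at *
  generalize Real.cot (Real.pi * s / 3 + Real.pi / 3) = X1 at *
  generalize Real.cot (Real.pi * s / 3 + 2 * Real.pi / 3) = X2 at *
  have hκ' : 2 * Real.pi / 3 * (a + b) / (Real.sqrt 3 * (a ^ 3 - b ^ 3)) * (3 / 2)
      = 2 * Real.pi / 3 * Real.sqrt 3 * κ := by
    rw [hκ]
    field_simp
    linear_combination (-1 : ℝ) * hq
  rw [hκ']
  have hQ2 : 1 / (2 * Q) = 1 / Q / 2 := by field_simp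
  have hQ3 : 2 * Real.pi / 3 / (3 * Q) = 2 * Real.pi / 9 * (1 / Q) := by field_simp; norm_num
  rw [hQ2, hQ3]
  linear_combination (-(Real.pi / 3) * (a ^ s / 6 - b ^ s / 2) * (1 / Q)) * t1
    + (-(Real.pi / 3) * (2 / 3 * a ^ s) * (1 / Q)) * t2
    + (-(Real.pi / 3) * κ * (a ^ s - b ^ s)) * t3

lemma measurable_ratFun (a b : ℝ) : Measurable (ratFun a b) := by
  unfold ratFun; fun_prop

/-- The logarithmic weight `log (t / a)` cancels the pole of `ratFun a b`. -/
noncomputable def logRatFun (a b t : ℝ) : ℝ :=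
  (Real.log t - Real.log a) * ratFun a b t

lemma measurable_logRatFun (a b : ℝ) : Measurable (logRatFun a b) :=
  (Real.measurable_log.sub_const _).mul (measurable_ratFun a b)

lemma logRatFun_nonneg {a b t : ℝ} (ha : 0 < a) (hb : 0 < b) (ht : 0 < t) :
    0 ≤ logRatFun a b t := by
  have hB : 0 < t ^ 2 + b * t + b ^ 2 := by positivity
  unfold logRatFun ratFun
  rcases lt_trichotomy t a with h | rfl | h
  · have h1 : Real.log t < Real.log a := Real.log_lt_log ht h
    have h2 : t ^ 3 < a ^ 3 := pow_lt_pow_left₀ h ht.le (by norm_num)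
    refine mul_nonneg_of_nonpos_of_nonpos (by linarith) (div_nonpos_of_nonneg_of_nonpos
      (by positivity) (mul_nonpos_of_nonpos_of_nonneg (by linarith) hB.le))
  · simp
  · have h1 : Real.log a < Real.log t := Real.log_lt_log ha h
    have h2 : a ^ 3 < t ^ 3 := pow_lt_pow_left₀ h ha.le (by norm_num)
    exact mul_nonneg (by linarith) (div_nonneg (by positivity) (mul_nonneg (by linarith) hB.le))

lemma logRatFun_le {a b t : ℝ} (ha : 0 < a) (hb : 0 < b) (ht : 0 < t) :
    logRatFun a b t ≤ 2 / a / (t ^ 2 + b ^ 2) := by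
  have hB : 0 < t ^ 2 + b * t + b ^ 2 := by positivity
  have hA : 0 < t ^ 2 + t * a + a ^ 2 := by positivity
  by_cases hta : t = a
  · subst hta
    simp only [logRatFun, sub_self, zero_mul]
    positivity
  have hta' : t - a ≠ 0 := sub_ne_zero.2 hta
  have hu : (Real.log t - Real.log a) / (t - a) ≤ (t + a) / (a * t) := by
    have e : (t + a) / (a * t) = 1 / a + 1 / t := by field_simp
    rw [e]
    rcases lt_or_gt_of_ne hta with h | h
    · have h1 := Real.log_le_sub_one_of_pos (div_pos ha ht)
      rw [Real.log_div ha.ne' ht.ne'] at h1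
      have h2 : a / t - 1 = (a - t) * (1 / t) := by field_simp
      have h3 : 0 < 1 / a := by positivity
      rw [← neg_div_neg_eq, div_le_iff₀ (by linarith)]
      nlinarith
    · have h1 := Real.log_le_sub_one_of_pos (div_pos ht ha)
      rw [Real.log_div ht.ne' ha.ne'] at h1
      have h2 : t / a - 1 = (t - a) * (1 / a) := by field_simp
      have h3 : 0 < 1 / t := by positivity
      rw [div_le_iff₀ (by linarith)]
      nlinarith
  have e : logRatFun a b t = (Real.log t - Real.log a) / (t - a) *
      (t * (t + a) / ((t ^ 2 + t * a + a ^ 2) * (t ^ 2 + b * t + b ^ 2))) := by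
    rw [logRatFun, ratFun, show t ^ 3 - a ^ 3 = (t - a) * (t ^ 2 + t * a + a ^ 2) by ring]
    field_simp
  calc logRatFun a b t ≤ (t + a) / (a * t) *
      (t * (t + a) / ((t ^ 2 + t * a + a ^ 2) * (t ^ 2 + b * t + b ^ 2))) := by
        rw [e]; gcongr
    _ = (t + a) ^ 2 / (t ^ 2 + t * a + a ^ 2) / a / (t ^ 2 + b * t + b ^ 2) := by
        field_simp
    _ ≤ 2 / a / (t ^ 2 + b ^ 2) := by
        gcongr
        · rw [div_le_iff₀ hA]
          nlinarith [sq_nonneg t, sq_nonneg a]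
        · nlinarith [mul_pos hb ht]

lemma integrableOn_rpow_mul_inv_sq_add_sq {b s : ℝ} (hb : 0 < b) (h1 : -1 < s) (h2 : s < 1) :
    IntegrableOn (fun t : ℝ => t ^ s * (t ^ 2 + b ^ 2)⁻¹) (Set.Ioi 0) := by
  have hm : Measurable (fun t : ℝ => t ^ s * (t ^ 2 + b ^ 2)⁻¹) := by fun_prop
  rw [← Set.Ioc_union_Ioi_eq_Ioi (zero_le_one (α := ℝ))]
  refine IntegrableOn.union ?_ ?_
  · have hi : IntegrableOn (fun t : ℝ => t ^ s * (b ^ 2)⁻¹) (Set.Ioc 0 1) :=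
      ((intervalIntegrable_iff_integrableOn_Ioc_of_le zero_le_one).1
        (intervalIntegral.intervalIntegrable_rpow' h1)).mul_const _
    refine hi.mono' hm.aestronglyMeasurable ?_
    filter_upwards [ae_restrict_mem measurableSet_Ioc] with t ht
    have h0 : 0 < t := ht.1
    rw [Real.norm_of_nonneg (by positivity)]
    gcongr
    nlinarith
  · have hi : IntegrableOn (fun t : ℝ => t ^ (s - 2)) (Set.Ioi 1) :=
      integrableOn_Ioi_rpow_of_lt (by linarith) one_pos
    refine hi.mono' hm.aestronglyMeasurable ?_
    filter_upwards [ae_restrict_mem measurableSet_Ioi] with t ht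
    have h0 : 0 < t := one_pos.trans ht
    rw [Real.norm_of_nonneg (by positivity), Real.rpow_sub h0, div_eq_mul_inv]
    gcongr
    rw [Real.rpow_two]
    nlinarith

lemma exp_mul_log_sub_log {a t : ℝ} (ha : 0 < a) (ht : 0 < t) (s : ℝ) :
    Real.exp (s * (Real.log t - Real.log a)) = a ^ (-s) * t ^ s := by
  rw [Real.rpow_def_of_pos ha, Real.rpow_def_of_pos ht, ← Real.exp_add]
  congr 1; ring

lemma integrableOn_exp_mul_logRatFun {a b s : ℝ} (ha : 0 < a) (hb : 0 < b) (h1 : -1 < s)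
    (h2 : s < 1) :
    IntegrableOn (fun t : ℝ => Real.exp (s * (Real.log t - Real.log a)) * logRatFun a b t)
      (Set.Ioi 0) := by
  refine ((integrableOn_rpow_mul_inv_sq_add_sq hb h1 h2).const_mul
    (a ^ (-s) * (2 / a))).mono' ?_ ?_
  · have := measurable_logRatFun a b
    exact Measurable.aestronglyMeasurable (by fun_prop)
  · filter_upwards [ae_restrict_mem measurableSet_Ioi] with t ht
    have h0 : 0 < t := ht
    have h3 := logRatFun_nonneg ha hb h0
    rw [Real.norm_of_nonneg (by positivity), exp_mul_log_sub_log ha h0]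
    calc a ^ (-s) * t ^ s * logRatFun a b t
        ≤ a ^ (-s) * t ^ s * (2 / a / (t ^ 2 + b ^ 2)) := by
          gcongr; exact logRatFun_le ha hb h0
      _ = _ := by ring

/-- The measure on `(0, ∞)` with density `logRatFun a b`. -/
noncomputable def logRatMeasure (a b : ℝ) : Measure ℝ :=
  (volume.restrict (Set.Ioi 0)).withDensity (fun t => ENNReal.ofReal (logRatFun a b t))

lemma toReal_ofReal_logRatFun_smul_ae {a b : ℝ} (ha : 0 < a) (hb : 0 < b) (g : ℝ → ℝ) :
    (fun t => (ENNReal.ofReal (logRatFun a b t)).toReal • g t)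
      =ᵐ[volume.restrict (Set.Ioi 0)] fun t => g t * logRatFun a b t := by
  filter_upwards [ae_restrict_mem measurableSet_Ioi] with t ht
  rw [ENNReal.toReal_ofReal (logRatFun_nonneg ha hb ht), smul_eq_mul, mul_comm]

lemma integrable_logRatMeasure_iff {a b : ℝ} (ha : 0 < a) (hb : 0 < b) (g : ℝ → ℝ) :
    Integrable g (logRatMeasure a b) ↔
      IntegrableOn (fun t => g t * logRatFun a b t) (Set.Ioi 0) := by
  rw [logRatMeasure, integrable_withDensity_iff_integrable_smul₀'
    (measurable_logRatFun a b).ennreal_ofReal.aemeasurable (by simp)]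
  exact integrable_congr (toReal_ofReal_logRatFun_smul_ae ha hb g)

lemma integral_logRatMeasure {a b : ℝ} (ha : 0 < a) (hb : 0 < b) (g : ℝ → ℝ) :
    ∫ t, g t ∂(logRatMeasure a b) = ∫ t in Set.Ioi 0, g t * logRatFun a b t := by
  rw [logRatMeasure, integral_withDensity_eq_integral_toReal_smul₀
    (measurable_logRatFun a b).ennreal_ofReal.aemeasurable (by simp)]
  exact integral_congr_ae (toReal_ofReal_logRatFun_smul_ae ha hb g)

lemma Ioo_subset_interior_integrableExpSet {a b : ℝ} (ha : 0 < a) (hb : 0 < b) :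
    Set.Ioo (-1) 1 ⊆ interior (ProbabilityTheory.integrableExpSet
      (fun t => Real.log t - Real.log a) (logRatMeasure a b)) := by
  refine interior_maximal (fun s hs => ?_) isOpen_Ioo
  exact (integrable_logRatMeasure_iff ha hb _).2
    (integrableOn_exp_mul_logRatFun ha hb hs.1 hs.2)

lemma integrableOn_pow_mul_logRatFun {a b : ℝ} (ha : 0 < a) (hb : 0 < b) (n : ℕ) :
    IntegrableOn (fun t => (Real.log t - Real.log a) ^ n * logRatFun a b t) (Set.Ioi 0) :=
  (integrable_logRatMeasure_iff ha hb _).1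
    (ProbabilityTheory.integrable_pow_of_mem_interior_integrableExpSet
      (Ioo_subset_interior_integrableExpSet ha hb (by norm_num)) n)

lemma abs_exp_sub_one_le (y : ℝ) : |Real.exp y - 1| ≤ |y| * (Real.exp y + 1) := by
  have h1 := Real.add_one_le_exp y
  have h2 := Real.exp_pos y
  rcases le_total 0 y with h | h
  · have h3 := Real.add_one_le_exp (-y)
    have h4 : Real.exp (-y) * Real.exp y = 1 := by rw [← Real.exp_add]; simp
    rw [abs_of_nonneg h, abs_of_nonneg (by linarith)]
    nlinarith
  · rw [abs_of_nonpos h, abs_of_nonpos (by have := Real.exp_le_one_iff.2 h; linarith)]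
    nlinarith

lemma integrableOn_exp_sub_one_mul_ratFun {a b s : ℝ} (ha : 0 < a) (hb : 0 < b) (h1 : -1 < s)
    (h2 : s < 1) :
    IntegrableOn (fun t : ℝ => (Real.exp (s * (Real.log t - Real.log a)) - 1) * ratFun a b t)
      (Set.Ioi 0) := by
  have hi := ((integrableOn_exp_mul_logRatFun ha hb h1 h2).add
    (integrableOn_pow_mul_logRatFun ha hb 0)).const_mul |s|
  refine hi.mono' ?_ ?_
  · have := measurable_ratFun a b
    exact Measurable.aestronglyMeasurable (by fun_prop)
  · filter_upwards [ae_restrict_mem measurableSet_Ioi] with t ht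
    have h3 := abs_of_nonneg (logRatFun_nonneg ha hb ht)
    rw [logRatFun, abs_mul] at h3
    rw [Real.norm_eq_abs, abs_mul]
    calc _ ≤ |s * (Real.log t - Real.log a)| *
          (Real.exp (s * (Real.log t - Real.log a)) + 1) * |ratFun a b t| := by
          gcongr; exact abs_exp_sub_one_le _
      _ = |s| * (Real.exp (s * (Real.log t - Real.log a)) + 1) *
          (|Real.log t - Real.log a| * |ratFun a b t|) := by rw [abs_mul]; ring
      _ = _ := by
        rw [h3]
        simp only [Pi.add_apply, logRatFun, pow_zero]
        ring

lemma integrableOn_ratFun_sub_poleFun {a b : ℝ} (ha : 0 < a) (hb : 0 < b) (hab : a ≠ b) :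
    IntegrableOn (fun t => ratFun a b t - poleFun a b t) (Set.Ioi 0) := by
  have h1 := ((integral_Ioi_rpow_mul_ratFun_sub (s := -(1 / 2)) ha hb hab (by norm_num)
    (by norm_num)).1).const_mul (a ^ (-(-(1 / 2) : ℝ)))
  have h2 := integrableOn_exp_sub_one_mul_ratFun (s := -(1 / 2)) ha hb (by norm_num)
    (by norm_num)
  refine IntegrableOn.congr_fun (h1.sub h2) (fun t ht => ?_) measurableSet_Ioi
  simp only [Pi.sub_apply]
  rw [exp_mul_log_sub_log ha ht]
  have : a ^ (-(-(1 / 2) : ℝ)) * a ^ (-(1 / 2) : ℝ) = 1 := by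
    rw [← Real.rpow_add ha]; simp
  linear_combination (-poleFun a b t) * this

/-- The regularized Mellin transform of `ratFun a b`, normalized by `a ^ s`. -/
noncomputable def regMellin (a b s : ℝ) : ℝ :=
  (∫ t in Set.Ioi (0 : ℝ), (Real.exp (s * (Real.log t - Real.log a)) - 1) * ratFun a b t)
    + ∫ t in Set.Ioi (0 : ℝ), (ratFun a b t - poleFun a b t)

lemma regMellin_zero (a b : ℝ) :
    regMellin a b 0 = ∫ t in Set.Ioi (0 : ℝ), (ratFun a b t - poleFun a b t) := by
  simp [regMellin]

lemma sin_mul_regMellin {a b s : ℝ} (ha : 0 < a) (hb : 0 < b) (hab : a ≠ b) (h1 : -1 < s)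
    (h2 : s < 0) :
    Real.sin (2 * Real.pi * s) * (a ^ s * regMellin a b s) = mellinNum a b s := by
  rw [← (integral_Ioi_rpow_mul_ratFun_sub ha hb hab h1 h2).2, regMellin, ← integral_add
    (integrableOn_exp_sub_one_mul_ratFun ha hb h1 (by linarith))
    (integrableOn_ratFun_sub_poleFun ha hb hab), ← integral_const_mul]
  congr 1
  refine setIntegral_congr_fun measurableSet_Ioi (fun t ht => ?_)
  have : a ^ s * a ^ (-s) = 1 := by rw [← Real.rpow_add ha]; simp
  rw [exp_mul_log_sub_log ha ht]
  linear_combination (t ^ s * ratFun a b t) * this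

lemma hasDerivAt_regMellin {a b s : ℝ} (ha : 0 < a) (hb : 0 < b) (hs : s ∈ Set.Ioo (-1) 1) :
    HasDerivAt (regMellin a b) (ProbabilityTheory.mgf (fun t => Real.log t - Real.log a)
      (logRatMeasure a b) s) s := by
  obtain ⟨r, hr, hr1⟩ := exists_between (abs_lt.2 hs)
  have hr0 : 0 ≤ r := (abs_nonneg s).trans hr.le
  rw [ProbabilityTheory.mgf, integral_logRatMeasure ha hb]
  have hm := measurable_ratFun a b
  have hm' := measurable_logRatFun a b
  refine ((hasDerivAt_integral_of_dominated_loc_of_deriv_le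
    (s := Set.Ioo (-r) r) (bound := fun t => Real.exp (r * (Real.log t - Real.log a)) *
      logRatFun a b t + Real.exp (-r * (Real.log t - Real.log a)) * logRatFun a b t)
    (μ := volume.restrict (Set.Ioi 0))
    (F := fun s t => (Real.exp (s * (Real.log t - Real.log a)) - 1) * ratFun a b t)
    (F' := fun s t => Real.exp (s * (Real.log t - Real.log a)) * logRatFun a b t)
    (isOpen_Ioo.mem_nhds (abs_lt.1 hr)) ?_
    (integrableOn_exp_sub_one_mul_ratFun ha hb hs.1 hs.2) ?_ ?_ ?_ ?_).2).add_const _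
  · exact Filter.Eventually.of_forall fun x =>
      Measurable.aestronglyMeasurable (by fun_prop)
  · exact Measurable.aestronglyMeasurable (by fun_prop)
  · filter_upwards [ae_restrict_mem measurableSet_Ioi] with t ht x hx
    have h3 := logRatFun_nonneg ha hb ht
    rw [Real.norm_of_nonneg (by positivity), ← add_mul]
    gcongr
    rcases le_total 0 (Real.log t - Real.log a) with h | h
    · refine le_add_of_le_of_nonneg (Real.exp_le_exp.2 ?_) (Real.exp_pos _).le
      exact mul_le_mul_of_nonneg_right hx.2.le h
    · refine le_add_of_nonneg_of_le (Real.exp_pos _).le (Real.exp_le_exp.2 ?_)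
      exact mul_le_mul_of_nonpos_right hx.1.le h
  · exact (integrableOn_exp_mul_logRatFun ha hb (by linarith) hr1).add
      (integrableOn_exp_mul_logRatFun ha hb (by linarith) (by linarith))
  · refine Filter.Eventually.of_forall fun t x _ => ?_
    have := ((((hasDerivAt_id x).mul_const (Real.log t - Real.log a)).exp).sub_const 1).mul_const
      (ratFun a b t)
    refine this.congr_deriv ?_
    simp only [id, logRatFun]
    ring

lemma contDiffOn_regMellin {a b : ℝ} (ha : 0 < a) (hb : 0 < b) (n : ℕ) :
    ContDiffOn ℝ n (regMellin a b) (Set.Ioo (-1) 1) := by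
  cases n with
  | zero =>
    exact contDiffOn_zero.2 fun s hs =>
      (hasDerivAt_regMellin ha hb hs).continuousAt.continuousWithinAt
  | succ n =>
    push_cast
    refine (contDiffOn_succ_iff_deriv_of_isOpen isOpen_Ioo).2 ⟨fun s hs =>
      (hasDerivAt_regMellin ha hb hs).differentiableAt.differentiableWithinAt, by simp, ?_⟩
    refine ContDiffOn.congr ?_ (fun s hs => (hasDerivAt_regMellin ha hb hs).deriv)
    exact ((ProbabilityTheory.analyticOnNhd_mgf.mono
      (Ioo_subset_interior_integrableExpSet ha hb)).contDiffOn (uniqueDiffOn_Ioo _ _))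

lemma iteratedDeriv_succ_regMellin_zero {a b : ℝ} (ha : 0 < a) (hb : 0 < b) (n : ℕ) :
    iteratedDeriv (n + 1) (regMellin a b) 0 =
      ∫ t in Set.Ioi (0 : ℝ), (Real.log t - Real.log a) ^ n * logRatFun a b t := by
  have h : deriv (regMellin a b) =ᶠ[nhds 0] ProbabilityTheory.mgf
      (fun t => Real.log t - Real.log a) (logRatMeasure a b) := by
    filter_upwards [isOpen_Ioo.mem_nhds (show (0 : ℝ) ∈ Set.Ioo (-1) 1 by norm_num)] with s hs
    exact (hasDerivAt_regMellin ha hb hs).deriv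
  rw [iteratedDeriv_succ', h.iteratedDeriv_eq, ProbabilityTheory.iteratedDeriv_mgf_zero
    (Ioo_subset_interior_integrableExpSet ha hb (by norm_num)), integral_logRatMeasure ha hb]
  rfl

/-- A primitive of `poleFun a b` away from `a`. -/
noncomputable def polePrim (a b t : ℝ) : ℝ :=
  2 / (3 * (a ^ 2 + a * b + b ^ 2)) *
    (Real.log (t ^ (3 / 2 : ℝ) - a ^ (3 / 2 : ℝ)) - Real.log (t ^ (3 / 2 : ℝ) + a ^ (3 / 2 : ℝ)))

lemma sq_rpow_three_halves {t : ℝ} (ht : 0 ≤ t) : (t ^ (3 / 2 : ℝ)) ^ 2 = t ^ 3 := by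
  rw [← Real.rpow_natCast, ← Real.rpow_mul ht, ← Real.rpow_natCast]
  norm_num

lemma hasDerivAt_polePrim {a b t : ℝ} (ha : 0 < a) (hb : 0 < b) (ht : 0 ≤ t) (hta : t ≠ a) :
    HasDerivAt (polePrim a b) (poleFun a b t) t := by
  have hd : HasDerivAt (fun x : ℝ => x ^ (3 / 2 : ℝ)) (3 / 2 * t ^ (1 / 2 : ℝ)) t := by
    convert Real.hasDerivAt_rpow_const (x := t) (p := 3 / 2) (Or.inr (by norm_num)) using 3
    norm_num
  have hA : 0 < a ^ (3 / 2 : ℝ) := by positivity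
  have hT : 0 ≤ t ^ (3 / 2 : ℝ) := by positivity
  have hsub : t ^ (3 / 2 : ℝ) - a ^ (3 / 2 : ℝ) ≠ 0 := by
    rw [sub_ne_zero]
    exact fun h => hta ((Real.rpow_left_inj ht ha.le (by norm_num)).1 h)
  have hadd : t ^ (3 / 2 : ℝ) + a ^ (3 / 2 : ℝ) ≠ 0 := by positivity
  refine ((((hd.sub_const _).log hsub).sub ((hd.add_const _).log hadd)).const_mul _).congr_deriv ?_
  have e : t ^ 3 - a ^ 3 = (t ^ (3 / 2 : ℝ) - a ^ (3 / 2 : ℝ)) *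
      (t ^ (3 / 2 : ℝ) + a ^ (3 / 2 : ℝ)) := by
    rw [← sq_rpow_three_halves ht, ← sq_rpow_three_halves ha.le]; ring
  have hQ : 0 < a ^ 2 + a * b + b ^ 2 := by positivity
  rw [poleFun, e]
  generalize t ^ (1 / 2 : ℝ) = r
  generalize t ^ (3 / 2 : ℝ) = T at *
  generalize a ^ (3 / 2 : ℝ) = A at *
  generalize a ^ 2 + a * b + b ^ 2 = Q at *
  field_simp
  ring

lemma polePrim_zero (a b : ℝ) : polePrim a b 0 = 0 := by
  simp [polePrim, Real.zero_rpow]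

lemma tendsto_polePrim_atTop {a b : ℝ} (ha : 0 < a) :
    Filter.Tendsto (polePrim a b) Filter.atTop (nhds 0) := by
  have hA : 0 < a ^ (3 / 2 : ℝ) := by positivity
  have h1 : Filter.Tendsto (fun T : ℝ => Real.log (1 - 2 * a ^ (3 / 2 : ℝ) / (T + a ^ (3 / 2 : ℝ))))
      Filter.atTop (nhds 0) := by
    have h : Filter.Tendsto (fun T : ℝ => 1 - 2 * a ^ (3 / 2 : ℝ) / (T + a ^ (3 / 2 : ℝ)))
        Filter.atTop (nhds (1 - 0)) :=
      tendsto_const_nhds.sub (tendsto_const_nhds.div_atTop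
        (Filter.tendsto_atTop_add_const_right _ _ Filter.tendsto_id))
    rw [sub_zero] at h
    simpa using h.log one_ne_zero
  have h2 := ((h1.comp (tendsto_rpow_atTop (y := 3 / 2) (by norm_num))).const_mul
    (2 / (3 * (a ^ 2 + a * b + b ^ 2))))
  rw [mul_zero] at h2
  refine h2.congr' ?_
  filter_upwards [Filter.eventually_gt_atTop a] with t ht
  have h3 : a ^ (3 / 2 : ℝ) < t ^ (3 / 2 : ℝ) := Real.rpow_lt_rpow ha.le ht (by norm_num)
  rw [Function.comp_apply, polePrim, ← Real.log_div (by linarith) (by linarith)]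
  have h4 : t ^ (3 / 2 : ℝ) + a ^ (3 / 2 : ℝ) ≠ 0 := by linarith
  congr 2
  rw [eq_div_iff h4, sub_mul, div_mul_cancel₀ _ h4]
  ring

lemma poleFun_left {a b c : ℝ} (ha : 0 < a) (hb : 0 < b) (hc : 0 ≤ c) (hca : c < a) :
    IntegrableOn (poleFun a b) (Set.Ioo 0 c) ∧
      ∫ t in Set.Ioo 0 c, poleFun a b t = polePrim a b c := by
  have hcont : ContinuousOn (poleFun a b) (Set.Icc 0 c) := by
    unfold poleFun
    refine ContinuousOn.div (ContinuousOn.mul continuousOn_const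
      (Real.continuous_rpow_const (by norm_num)).continuousOn) (by fun_prop) fun t ht => ?_
    have := pow_lt_pow_left₀ (ht.2.trans_lt hca) ht.1 (n := 3) (by norm_num)
    linarith
  have hi : IntervalIntegrable (poleFun a b) volume 0 c :=
    ContinuousOn.intervalIntegrable (by rwa [Set.uIcc_of_le hc])
  refine ⟨(hcont.integrableOn_Icc).mono_set Set.Ioo_subset_Icc_self, ?_⟩
  rw [← integral_Ioc_eq_integral_Ioo, ← intervalIntegral.integral_of_le hc,
    intervalIntegral.integral_eq_sub_of_hasDerivAt (f := polePrim a b) (fun t ht => ?_) hi,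
    polePrim_zero, sub_zero]
  rw [Set.uIcc_of_le hc] at ht
  exact hasDerivAt_polePrim ha hb ht.1 (ht.2.trans_lt hca).ne

lemma poleFun_right {a b c : ℝ} (ha : 0 < a) (hb : 0 < b) (hca : a < c) :
    IntegrableOn (poleFun a b) (Set.Ioi c) ∧
      ∫ t in Set.Ioi c, poleFun a b t = -polePrim a b c := by
  have hd : ∀ t ∈ Set.Ici c, HasDerivAt (polePrim a b) (poleFun a b t) t := fun t ht =>
    hasDerivAt_polePrim ha hb (ha.trans (hca.trans_le ht)).le (hca.trans_le ht).ne'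
  have hp : ∀ t ∈ Set.Ioi c, 0 ≤ poleFun a b t := fun t ht => by
    have h0 : a < t := hca.trans ht
    have h1 : 0 < t := ha.trans h0
    have h2 := pow_lt_pow_left₀ h0 ha.le (n := 3) (by norm_num)
    exact div_nonneg (by positivity) (by linarith)
  refine ⟨integrableOn_Ioi_deriv_of_nonneg' hd hp (tendsto_polePrim_atTop ha), ?_⟩
  rw [integral_Ioi_of_hasDerivAt_of_nonneg' hd hp (tendsto_polePrim_atTop ha), zero_sub]

lemma tendsto_polePrim_sub {a b : ℝ} (ha : 0 < a) :
    Filter.Tendsto (fun ε => polePrim a b (a - ε) + -polePrim a b (a + ε))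
      (nhdsWithin 0 (Set.Ioi 0)) (nhds 0) := by
  have hd : HasDerivAt (fun x : ℝ => x ^ (3 / 2 : ℝ)) (3 / 2 * a ^ (3 / 2 - 1 : ℝ)) a :=
    Real.hasDerivAt_rpow_const (Or.inr (by norm_num))
  have hd0 : 3 / 2 * a ^ (3 / 2 - 1 : ℝ) ≠ 0 := by positivity
  have hA : 0 < a ^ (3 / 2 : ℝ) := by positivity
  have hs := hd.tendsto_slope_zero
  have hpos : Filter.Tendsto (fun ε : ℝ => ε) (nhdsWithin 0 (Set.Ioi 0)) (nhdsWithin 0 {0}ᶜ) :=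
    tendsto_nhdsWithin_mono_right (fun x hx => (ne_of_gt hx : x ≠ 0))
      (Filter.tendsto_id.mono_right le_rfl)
  have hneg : Filter.Tendsto (fun ε : ℝ => -ε) (nhdsWithin 0 (Set.Ioi 0))
      (nhdsWithin 0 {0}ᶜ) := by
    refine tendsto_nhdsWithin_iff.2 ⟨?_, ?_⟩
    · have : Filter.Tendsto (fun ε : ℝ => -ε) (nhds 0) (nhds (-0)) := continuous_neg.tendsto 0
      rw [neg_zero] at this
      exact this.mono_left nhdsWithin_le_nhds
    · filter_upwards [self_mem_nhdsWithin] with ε hε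
      exact (neg_ne_zero.2 (ne_of_gt hε) : -ε ≠ 0)
  have h1 := (hs.comp hpos).log hd0
  have h2 := (hs.comp hneg).log hd0
  have h3 : ∀ u : ℝ → ℝ, Filter.Tendsto u (nhdsWithin 0 (Set.Ioi 0)) (nhdsWithin 0 {0}ᶜ) →
      Filter.Tendsto (fun ε => Real.log ((a + u ε) ^ (3 / 2 : ℝ) + a ^ (3 / 2 : ℝ)))
      (nhdsWithin 0 (Set.Ioi 0)) (nhds (Real.log (a ^ (3 / 2 : ℝ) + a ^ (3 / 2 : ℝ)))) := by
    intro u hu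
    have hu' : Filter.Tendsto (fun ε => a + u ε) (nhdsWithin 0 (Set.Ioi 0)) (nhds (a + 0)) :=
      tendsto_const_nhds.add (hu.mono_right nhdsWithin_le_nhds)
    rw [add_zero] at hu'
    exact ((hu'.rpow_const (Or.inl ha.ne')).add_const _).log (by positivity)
  have h4 := ((h2.sub (h3 _ hneg)).sub (h1.sub (h3 _ hpos))).const_mul
    (2 / (3 * (a ^ 2 + a * b + b ^ 2)))
  rw [sub_self, mul_zero] at h4
  refine h4.congr' ?_
  filter_upwards [Ioo_mem_nhdsGT ha] with ε hε
  have hε0 : ε ≠ 0 := hε.1.ne'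
  have e1 : (a + ε) ^ (3 / 2 : ℝ) - a ^ (3 / 2 : ℝ) ≠ 0 := by
    have := Real.rpow_lt_rpow ha.le (show a < a + ε by linarith [hε.1]) (z := 3 / 2) (by norm_num)
    linarith
  have e2 : (a + -ε) ^ (3 / 2 : ℝ) - a ^ (3 / 2 : ℝ) ≠ 0 := by
    have := Real.rpow_lt_rpow (by linarith [hε.2]) (show a + -ε < a by linarith [hε.1])
      (z := 3 / 2) (by norm_num)
    linarith
  simp only [Function.comp_apply, smul_eq_mul]
  rw [Real.log_mul (inv_ne_zero hε0) e1, Real.log_mul (inv_ne_zero (neg_ne_zero.2 hε0)) e2,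
    polePrim, polePrim, inv_neg, Real.log_neg_eq_log, ← sub_eq_add_neg a ε]
  ring

lemma tendsto_setIntegral_Ioo_add_Ioi {a : ℝ} {Φ : ℝ → ℝ} (ha : 0 < a)
    (hΦ : IntegrableOn Φ (Set.Ioi 0)) :
    Filter.Tendsto (fun ε => (∫ t in Set.Ioo 0 (a - ε), Φ t) + ∫ t in Set.Ioi (a + ε), Φ t)
      (nhdsWithin 0 (Set.Ioi 0)) (nhds (∫ t in Set.Ioi 0, Φ t)) := by
  have h : Filter.Tendsto (fun ε => ∫ t in Set.Ioi (0 : ℝ),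
      (Set.Ioo 0 (a - ε) ∪ Set.Ioi (a + ε)).indicator Φ t)
      (nhdsWithin 0 (Set.Ioi 0)) (nhds (∫ t in Set.Ioi 0, Φ t)) := by
    refine tendsto_integral_filter_of_dominated_convergence (fun t => ‖Φ t‖) ?_ ?_ hΦ.norm ?_
    · exact Filter.Eventually.of_forall fun ε =>
        hΦ.aestronglyMeasurable.indicator (measurableSet_Ioo.union measurableSet_Ioi)
    · exact Filter.Eventually.of_forall fun ε => Filter.Eventually.of_forall fun t =>
        norm_indicator_le_norm_self _ _
    · filter_upwards [ae_restrict_mem measurableSet_Ioi,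
        Measure.ae_ne (volume.restrict (Set.Ioi (0 : ℝ))) a] with t ht hta
      refine tendsto_const_nhds.congr' ?_
      have ht0 : 0 < t := ht
      filter_upwards [Ioo_mem_nhdsGT (abs_pos.2 (sub_ne_zero.2 hta))] with ε hε
      rw [Set.indicator_of_mem]
      rcases lt_or_gt_of_ne hta with h | h
      · rw [abs_of_neg (by linarith)] at hε
        exact Or.inl ⟨ht0, by linarith [hε.2]⟩
      · rw [abs_of_pos (by linarith)] at hε
        exact Or.inr (show a + ε < t by linarith [hε.2])
  refine h.congr' ?_
  filter_upwards [Ioo_mem_nhdsGT ha] with ε hε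
  have hsub : Set.Ioi (a + ε) ⊆ Set.Ioi 0 := Set.Ioi_subset_Ioi (by linarith [hε.1])
  have hsub' : Set.Ioo 0 (a - ε) ⊆ Set.Ioi 0 := fun t ht => ht.1
  rw [setIntegral_indicator (measurableSet_Ioo.union measurableSet_Ioi),
    Set.inter_eq_right.2 (Set.union_subset hsub' hsub), setIntegral_union ?_ measurableSet_Ioi
      (hΦ.mono_set hsub') (hΦ.mono_set hsub)]
  refine Set.disjoint_left.2 fun t h1 h2 => ?_
  have h3 : a + ε < t := h2
  linarith [h1.2, hε.1]

/-- The integrands whose integrals are the derivatives at `0` of `regMellin a b`. -/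
noncomputable def logMoment (a b : ℝ) : ℕ → ℝ → ℝ
  | 0, t => ratFun a b t - poleFun a b t
  | n + 1, t => (Real.log t - Real.log a) ^ n * logRatFun a b t

lemma integral_logMoment {a b : ℝ} (ha : 0 < a) (hb : 0 < b) (hab : a ≠ b) (n : ℕ) :
    IntegrableOn (logMoment a b n) (Set.Ioi 0) ∧
      ∫ t in Set.Ioi (0 : ℝ), logMoment a b n t = iteratedDeriv n (regMellin a b) 0 := by
  cases n with
  | zero => exact ⟨integrableOn_ratFun_sub_poleFun ha hb hab, by
      rw [iteratedDeriv_zero, regMellin_zero]; rfl⟩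
  | succ n => exact ⟨integrableOn_pow_mul_logRatFun ha hb n, by
      rw [iteratedDeriv_succ_regMellin_zero ha hb]; rfl⟩

lemma sum_logMoment (a b t : ℝ) (k : ℕ) :
    ∑ j ∈ range (k + 1), (k.choose j : ℝ) * Real.log a ^ (k - j) * logMoment a b j t =
      Real.log t ^ k * ratFun a b t - Real.log a ^ k * poleFun a b t := by
  have h : ∀ j, logMoment a b j t = (Real.log t - Real.log a) ^ j * ratFun a b t
      - if j = 0 then poleFun a b t else 0 := by
    intro j
    cases j with
    | zero => simp [logMoment]
    | succ n => simp [logMoment, logRatFun, pow_succ]; ring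
  simp only [h, mul_sub, Finset.sum_sub_distrib, mul_ite, mul_zero]
  rw [Finset.sum_ite_eq' (range (k + 1)) 0, if_pos (by simp)]
  have hk : Real.log t ^ k = ((Real.log t - Real.log a) + Real.log a) ^ k := by simp
  rw [hk, add_pow, Finset.sum_mul]
  congr 1
  · exact Finset.sum_congr rfl fun j _ => by ring
  · simp

/-- The principal value of `log ^ k` against `ratFun a b`. -/
noncomputable def pvMoment (a b : ℝ) (k : ℕ) : ℝ :=
  iteratedDeriv k (fun s => a ^ s * regMellin a b s) 0

lemma rpow_eq_exp_log_mul {a : ℝ} (ha : 0 < a) :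
    (fun s : ℝ => a ^ s) = fun s => Real.exp (Real.log a * s) := by
  funext s; rw [Real.rpow_def_of_pos ha]

lemma contDiff_const_rpow {a : ℝ} (ha : 0 < a) {n : WithTop ℕ∞} :
    ContDiff ℝ n (fun s : ℝ => a ^ s) := by
  rw [rpow_eq_exp_log_mul ha]; fun_prop

lemma iteratedDeriv_const_rpow_zero {a : ℝ} (ha : 0 < a) (n : ℕ) :
    iteratedDeriv n (fun s : ℝ => a ^ s) 0 = Real.log a ^ n := by
  rw [rpow_eq_exp_log_mul ha, iteratedDeriv_exp_const_mul]; simp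

lemma contDiffAt_regMellin {a b : ℝ} (ha : 0 < a) (hb : 0 < b) (n : ℕ) :
    ContDiffAt ℝ n (regMellin a b) 0 :=
  (contDiffOn_regMellin ha hb n).contDiffAt (isOpen_Ioo.mem_nhds (by norm_num))

lemma pvMoment_eq_sum {a b : ℝ} (ha : 0 < a) (hb : 0 < b) (k : ℕ) :
    pvMoment a b k = ∑ j ∈ range (k + 1),
      (k.choose j : ℝ) * Real.log a ^ (k - j) * iteratedDeriv j (regMellin a b) 0 := by
  rw [pvMoment, iteratedDeriv_fun_mul (contDiff_const_rpow ha).contDiffAt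
    (contDiffAt_regMellin ha hb k), ← Finset.sum_range_reflect]
  refine Finset.sum_congr rfl fun j hj => ?_
  have hj' : j ≤ k := Nat.lt_succ_iff.1 (Finset.mem_range.1 hj)
  rw [iteratedDeriv_const_rpow_zero ha, Nat.add_sub_cancel, Nat.choose_symm hj',
    Nat.sub_sub_self hj']

lemma tendsto_pv_log_pow_mul_ratFun {a b : ℝ} (ha : 0 < a) (hb : 0 < b) (hab : a ≠ b) (k : ℕ) :
    Filter.Tendsto (fun ε : ℝ => (∫ t in Set.Ioo (0 : ℝ) (a - ε), Real.log t ^ k * ratFun a b t)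
        + ∫ t in Set.Ioi (a + ε), Real.log t ^ k * ratFun a b t)
      (nhdsWithin 0 (Set.Ioi 0)) (nhds (pvMoment a b k)) := by
  have hi : ∀ j ∈ range (k + 1), IntegrableOn (fun t =>
      (k.choose j : ℝ) * Real.log a ^ (k - j) * logMoment a b j t) (Set.Ioi 0) := fun j _ =>
    (integral_logMoment ha hb hab j).1.const_mul _
  have hΦ : IntegrableOn (fun t => ∑ j ∈ range (k + 1),
      (k.choose j : ℝ) * Real.log a ^ (k - j) * logMoment a b j t) (Set.Ioi 0) :=
    integrable_finsetSum _ hi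
  have hI : ∫ t in Set.Ioi (0 : ℝ), ∑ j ∈ range (k + 1),
      (k.choose j : ℝ) * Real.log a ^ (k - j) * logMoment a b j t = pvMoment a b k := by
    rw [integral_finsetSum _ hi, pvMoment_eq_sum ha hb]
    exact Finset.sum_congr rfl fun j _ => by
      rw [integral_const_mul, (integral_logMoment ha hb hab j).2]
  have h := (tendsto_setIntegral_Ioo_add_Ioi ha hΦ).add
    ((tendsto_polePrim_sub (b := b) ha).const_mul (Real.log a ^ k))
  rw [hI, mul_zero, add_zero] at h
  refine h.congr' ?_
  simp only [sum_logMoment] at hΦ ⊢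
  filter_upwards [Ioo_mem_nhdsGT ha] with ε hε
  obtain ⟨i1, e1⟩ := poleFun_left (c := a - ε) ha hb (by linarith [hε.2]) (by linarith [hε.1])
  obtain ⟨i2, e2⟩ := poleFun_right (c := a + ε) ha hb (by linarith [hε.1])
  have hsplit : ∀ S : Set ℝ, S ⊆ Set.Ioi 0 → IntegrableOn (poleFun a b) S →
      ∫ t in S, Real.log t ^ k * ratFun a b t =
        (∫ t in S, (Real.log t ^ k * ratFun a b t - Real.log a ^ k * poleFun a b t))
          + Real.log a ^ k * ∫ t in S, poleFun a b t := by
    intro S hS hp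
    rw [← integral_const_mul, ← integral_add (hΦ.mono_set hS) (hp.const_mul _)]
    simp
  rw [hsplit _ (fun t ht => ht.1) i1, hsplit _ (Set.Ioi_subset_Ioi (by linarith [hε.1])) i2,
    e1, e2]
  ring

lemma iteratedDeriv_sin_zero_of_even {j : ℕ} (hj : Even j) : iteratedDeriv j Real.sin 0 = 0 := by
  obtain ⟨m, rfl⟩ := even_iff_exists_two_mul.1 hj
  simp

lemma iteratedDeriv_sin_zero_of_odd {j : ℕ} (hj : Odd j) :
    iteratedDeriv j Real.sin 0 = (-1) ^ ((j - 1) / 2) := by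
  obtain ⟨m, rfl⟩ := hj
  simp

lemma iteratedDeriv_cos_zero_of_odd {j : ℕ} (hj : Odd j) : iteratedDeriv j Real.cos 0 = 0 := by
  obtain ⟨m, rfl⟩ := hj
  simp

lemma iteratedDeriv_cos_zero_of_even {j : ℕ} (hj : Even j) :
    iteratedDeriv j Real.cos 0 = (-1) ^ (j / 2) := by
  obtain ⟨m, rfl⟩ := even_iff_exists_two_mul.1 hj
  simp

lemma neg_one_pow_succ_half_of_odd {j : ℕ} (hj : Odd j) :
    (-1 : ℝ) ^ ((j + 1) / 2) = -iteratedDeriv j Real.sin 0 := by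
  rw [iteratedDeriv_sin_zero_of_odd hj]
  obtain ⟨m, rfl⟩ := hj
  rw [show (2 * m + 1 + 1) / 2 = m + 1 by omega, show (2 * m + 1 - 1) / 2 = m by omega, pow_succ]
  ring

lemma recFam_eq (m : ℝ) (G : ℕ → Polynomial ℝ) (k : ℕ) :
    recFam m G k = Polynomial.C ((1 : ℝ) / (k + 1)) *
      (∑ j ∈ (Finset.range (k + 2)).filter (fun j => Odd j ∧ 3 ≤ j),
        Polynomial.C ((-1 : ℝ) ^ ((j + 1) / 2) * ((k + 1).choose j : ℝ) * m ^ (j - 1)) *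
          recFam m G (k + 1 - j)) + G k := by
  rw [← Finset.sum_attach]
  conv_lhs => rw [recFam, Nat.strongRecOn_eq]
  rfl

/-- The recursion defining `recFam`, as a binomial convolution with the derivatives of `sin`. -/
lemma sum_choose_mul_recFam (m : ℝ) (G : ℕ → Polynomial ℝ) (k : ℕ) (x : ℝ) :
    ∑ j ∈ range (k + 2), ((k + 1).choose j : ℝ) * iteratedDeriv j Real.sin 0 * m ^ j *
      (recFam m G (k + 1 - j)).eval x = (k + 1) * m * (G k).eval x := by
  have hk : (k + 1 : ℝ) ≠ 0 := by positivity
  have h := congrArg (Polynomial.eval x) (recFam_eq m G k)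
  simp only [Polynomial.eval_add, Polynomial.eval_mul, Polynomial.eval_C,
    Polynomial.eval_finsetSum] at h
  rw [Finset.sum_range_succ', Finset.sum_range_succ']
  have h0 : ∑ j ∈ (range (k + 2)).filter (fun j => Odd j ∧ 3 ≤ j),
      (-1 : ℝ) ^ ((j + 1) / 2) * ((k + 1).choose j : ℝ) * m ^ j *
        (recFam m G (k + 1 - j)).eval x =
      -∑ j ∈ range k, ((k + 1).choose (j + 1 + 1) : ℝ) * iteratedDeriv (j + 1 + 1) Real.sin 0 *
        m ^ (j + 1 + 1) * (recFam m G (k + 1 - (j + 1 + 1))).eval x := by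
    rw [Finset.sum_filter, Finset.sum_range_succ', Finset.sum_range_succ',
      ← Finset.sum_neg_distrib]
    simp only [zero_add, Nat.not_ofNat_le_one, and_false, if_false, add_zero,
      Nat.not_odd_zero, false_and]
    refine Finset.sum_congr rfl fun j _ => ?_
    by_cases hj : Odd (j + 1 + 1)
    · have h3 : 3 ≤ j + 1 + 1 := by
        obtain ⟨r, hr⟩ := hj; omega
      rw [if_pos ⟨hj, h3⟩, neg_one_pow_succ_half_of_odd hj]
      ring
    · rw [if_neg (fun h => hj h.1), iteratedDeriv_sin_zero_of_even (Nat.not_odd_iff_even.1 hj)]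
      ring
  have h1 : m * ∑ j ∈ (range (k + 2)).filter (fun j => Odd j ∧ 3 ≤ j),
      (-1 : ℝ) ^ ((j + 1) / 2) * ((k + 1).choose j : ℝ) * m ^ (j - 1) *
        (recFam m G (k + 1 - j)).eval x =
      ∑ j ∈ (range (k + 2)).filter (fun j => Odd j ∧ 3 ≤ j),
      (-1 : ℝ) ^ ((j + 1) / 2) * ((k + 1).choose j : ℝ) * m ^ j *
        (recFam m G (k + 1 - j)).eval x := by
    rw [Finset.mul_sum]
    refine Finset.sum_congr rfl fun j hj => ?_
    have h3 : 3 ≤ j := (Finset.mem_filter.1 hj).2.2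
    rw [show m ^ j = m ^ (j - 1) * m by rw [← pow_succ]; congr 1; omega]
    ring
  have h2 : ((k : ℝ) + 1) * (recFam m G k).eval x =
      ∑ j ∈ (range (k + 2)).filter (fun j => Odd j ∧ 3 ≤ j),
        (-1 : ℝ) ^ ((j + 1) / 2) * ((k + 1).choose j : ℝ) * m ^ (j - 1) *
        (recFam m G (k + 1 - j)).eval x + (k + 1) * (G k).eval x := by
    rw [h]; field_simp
  rw [h0] at h1
  have s1 : iteratedDeriv (0 + 1) Real.sin 0 = 1 := by simp
  have s0 : iteratedDeriv 0 Real.sin 0 = 0 := by simp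
  rw [s1, s0]
  simp only [Nat.add_sub_add_right] at h1
  simp only [zero_add, Nat.choose_one_right, Nat.add_sub_add_right, Nat.add_sub_cancel, pow_one]
  push_cast
  linear_combination m * h2 + h1

lemma eval_GR (k : ℕ) (x : ℝ) : (k + 1) * (GR k).eval x = 1 / 2 *
    ∑ j ∈ range (k + 2), ((k + 1).choose j : ℝ) * x ^ (k + 1 - j) *
      ((2 ^ j + 1) * iteratedDeriv j Real.cos 0) := by
  have hk : (k + 1 : ℝ) ≠ 0 := by positivity
  rw [GR, Polynomial.eval_mul, Polynomial.eval_C, Polynomial.eval_finsetSum, Finset.sum_filter,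
    ← mul_assoc, show (k + 1 : ℝ) * (1 / (2 * (k + 1))) = 1 / 2 by field_simp]
  congr 1
  refine Finset.sum_congr rfl fun j _ => ?_
  split_ifs with hj
  · simp [iteratedDeriv_cos_zero_of_even hj]; ring
  · simp [iteratedDeriv_cos_zero_of_odd (Nat.not_even_iff_odd.1 hj)]

lemma eval_GS (k : ℕ) (x : ℝ) : (k + 1) * (GS k).eval x = -(1 / 2) *
    ∑ j ∈ range (k + 2), ((k + 1).choose j : ℝ) * x ^ (k + 1 - j) *
      ((2 ^ j - 1) * iteratedDeriv j Real.sin 0) := by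
  have hk : (k + 1 : ℝ) ≠ 0 := by positivity
  rw [GS, Polynomial.eval_mul, Polynomial.eval_C, Polynomial.eval_finsetSum, Finset.sum_filter,
    ← mul_assoc, show (k + 1 : ℝ) * (1 / (2 * (k + 1))) = 1 / 2 by field_simp, neg_mul,
    ← mul_neg, ← Finset.sum_neg_distrib]
  congr 1
  refine Finset.sum_congr rfl fun j _ => ?_
  split_ifs with hj
  · simp [neg_one_pow_succ_half_of_odd hj]; ring
  · simp [iteratedDeriv_sin_zero_of_even (Nat.not_odd_iff_even.1 hj)]

lemma eval_GY (k : ℕ) (x : ℝ) : (k + 1) * (GY k).eval x =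
    -∑ j ∈ range (k + 2), ((k + 1).choose j : ℝ) * x ^ (k + 1 - j) *
      ((0 ^ j + 3 ^ j) * iteratedDeriv j Real.cos 0) := by
  have hk : (k + 1 : ℝ) ≠ 0 := by positivity
  have h0 : ∑ j ∈ range (k + 2), ((k + 1).choose j : ℝ) * x ^ (k + 1 - j) *
      (0 ^ j * iteratedDeriv j Real.cos 0) = x ^ (k + 1) := by
    rw [Finset.sum_range_succ', Finset.sum_eq_zero (fun j _ => by simp)]
    simp
  have h1 : ∑ j ∈ range (k + 2), ((k + 1).choose j : ℝ) * x ^ (k + 1 - j) *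
      ((0 ^ j + 3 ^ j) * iteratedDeriv j Real.cos 0) = x ^ (k + 1) +
      ∑ j ∈ range (k + 2), ((k + 1).choose j : ℝ) * x ^ (k + 1 - j) *
        (3 ^ j * iteratedDeriv j Real.cos 0) := by
    rw [← h0, ← Finset.sum_add_distrib]
    exact Finset.sum_congr rfl fun j _ => by ring
  rw [h1, GY, Polynomial.eval_mul, Polynomial.eval_C, Polynomial.eval_add,
    Polynomial.eval_finsetSum, Finset.sum_filter, Polynomial.eval_pow, Polynomial.eval_X]
  rw [← mul_assoc, show (k + 1 : ℝ) * -(1 / (k + 1)) = -1 by field_simp, neg_one_mul]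
  congr 2
  refine Finset.sum_congr rfl fun j _ => ?_
  split_ifs with hj
  · simp [iteratedDeriv_cos_zero_of_even hj]; ring
  · simp [iteratedDeriv_cos_zero_of_odd (Nat.not_even_iff_odd.1 hj)]

lemma eq_of_sum_choose_mul_sin {U V : ℕ → ℝ} {c : ℝ} (hc : c ≠ 0)
    (h : ∀ k, ∑ j ∈ range (k + 2), ((k + 1).choose j : ℝ) * iteratedDeriv j Real.sin 0 * c ^ j *
        U (k + 1 - j) =
      ∑ j ∈ range (k + 2), ((k + 1).choose j : ℝ) * iteratedDeriv j Real.sin 0 * c ^ j *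
        V (k + 1 - j)) (k : ℕ) : U k = V k := by
  induction k using Nat.strong_induction_on with
  | _ k ih =>
    have hk := h k
    rw [Finset.sum_range_succ', Finset.sum_range_succ', Finset.sum_range_succ' _ (k + 1),
      Finset.sum_range_succ' _ k] at hk
    have e : ∑ j ∈ range k, ((k + 1).choose (j + 1 + 1) : ℝ) *
          iteratedDeriv (j + 1 + 1) Real.sin 0 * c ^ (j + 1 + 1) * U (k + 1 - (j + 1 + 1)) =
        ∑ j ∈ range k, ((k + 1).choose (j + 1 + 1) : ℝ) *
          iteratedDeriv (j + 1 + 1) Real.sin 0 * c ^ (j + 1 + 1) * V (k + 1 - (j + 1 + 1)) :=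
      Finset.sum_congr rfl fun j hj => by
        rw [ih _ (by have := Finset.mem_range.1 hj; omega)]
    have s1 : iteratedDeriv (0 + 1) Real.sin 0 = 1 := by simp
    have s0 : iteratedDeriv 0 Real.sin 0 = 0 := by simp
    rw [e, s1, s0] at hk
    simp only [zero_add, Nat.choose_one_right, Nat.add_sub_cancel, pow_one] at hk
    push_cast at hk
    have hk' : ((k : ℝ) + 1) * c ≠ 0 := mul_ne_zero (by positivity) hc
    exact mul_left_cancel₀ hk' (by linear_combination hk)

lemma iteratedDeriv_zero_of_eq_zero_left {h : ℝ → ℝ} {n : ℕ}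
    (hc : ContDiffOn ℝ n h (Set.Ioo (-1) 1)) (h0 : ∀ s, -1 < s → s < 0 → h s = 0) :
    iteratedDeriv n h 0 = 0 := by
  have hcont : ContinuousAt (iteratedDeriv n h) 0 := by
    have h1 := hc.continuousOn_iteratedDerivWithin le_rfl (uniqueDiffOn_Ioo _ _)
    have h2 : ContinuousOn (iteratedDeriv n h) (Set.Ioo (-1) 1) :=
      h1.congr fun s hs => (iteratedDerivWithin_of_isOpen isOpen_Ioo hs).symm
    exact h2.continuousAt (isOpen_Ioo.mem_nhds (by norm_num))
  have hz : iteratedDeriv n h =ᶠ[nhdsWithin 0 (Set.Iio 0)] fun _ => 0 := by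
    filter_upwards [Ioo_mem_nhdsLT (show (-1 : ℝ) < 0 by norm_num)] with s hs
    have : h =ᶠ[nhds s] fun _ => 0 := by
      filter_upwards [isOpen_Ioo.mem_nhds hs] with r hr using h0 r hr.1 hr.2
    rw [this.iteratedDeriv_eq, iteratedDeriv_const]
    simp
  exact tendsto_nhds_unique (hcont.tendsto.mono_left nhdsWithin_le_nhds)
    (tendsto_const_nhds.congr' hz.symm)

lemma iteratedDeriv_trig_zero (p₀ p q θ : ℝ) (n : ℕ) :
    iteratedDeriv n (fun s => p₀ * (1 + Real.cos (3 * θ * s)) +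
      p * (Real.cos (2 * θ * s) + Real.cos (θ * s)) +
      q * (Real.sin (2 * θ * s) - Real.sin (θ * s))) 0 =
    θ ^ n * (p₀ * ((0 ^ n + 3 ^ n) * iteratedDeriv n Real.cos 0) +
      p * ((2 ^ n + 1) * iteratedDeriv n Real.cos 0) +
      q * ((2 ^ n - 1) * iteratedDeriv n Real.sin 0)) := by
  have h1 : (iteratedDeriv n (fun _ : ℝ => (1 : ℝ)) 0) = 0 ^ n * iteratedDeriv n Real.cos 0 := by
    rcases n with _ | n
    · simp
    · simp [iteratedDeriv_const]
  have hz : θ ^ n * (0 : ℝ) ^ n = 0 ^ n := by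
    rw [← mul_pow, mul_zero]
  rw [iteratedDeriv_fun_add (by fun_prop) (by fun_prop),
    iteratedDeriv_fun_add (by fun_prop) (by fun_prop), iteratedDeriv_const_mul_field,
    iteratedDeriv_const_mul_field, iteratedDeriv_const_mul_field,
    iteratedDeriv_fun_add (by fun_prop) (by fun_prop),
    iteratedDeriv_fun_add (by fun_prop) (by fun_prop),
    iteratedDeriv_fun_sub (by fun_prop) (by fun_prop), h1,
    iteratedDeriv_comp_const_mul Real.contDiff_cos, iteratedDeriv_comp_const_mul Real.contDiff_cos,
    iteratedDeriv_comp_const_mul Real.contDiff_cos, iteratedDeriv_comp_const_mul Real.contDiff_sin,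
    iteratedDeriv_comp_const_mul Real.contDiff_sin]
  simp only [mul_zero, mul_pow]
  linear_combination -p₀ * iteratedDeriv n Real.cos 0 * hz

/-- Leibniz rule for a trigonometric polynomial times `c ^ s`, expressed by `GR`, `GS`, `GY`. -/
lemma iteratedDeriv_trig_mul_rpow_zero {c θ : ℝ} (hc : 0 < c) (hθ : θ ≠ 0) (p₀ p q : ℝ) (k : ℕ) :
    iteratedDeriv (k + 1) (fun s => (p₀ * (1 + Real.cos (3 * θ * s)) +
      p * (Real.cos (2 * θ * s) + Real.cos (θ * s)) +
      q * (Real.sin (2 * θ * s) - Real.sin (θ * s))) * c ^ s) 0 =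
    θ ^ (k + 1) * (k + 1) * (-p₀ * (GY k).eval (Real.log c / θ) +
      2 * p * (GR k).eval (Real.log c / θ) - 2 * q * (GS k).eval (Real.log c / θ)) := by
  have hl : Real.log c = Real.log c / θ * θ := by field_simp
  set x := Real.log c / θ
  rw [iteratedDeriv_fun_mul (by fun_prop) (contDiff_const_rpow hc).contDiffAt]
  have hsum : ∀ j ∈ range (k + 1 + 1), ((k + 1).choose j : ℝ) * (θ ^ j *
      (p₀ * ((0 ^ j + 3 ^ j) * iteratedDeriv j Real.cos 0) +
        p * ((2 ^ j + 1) * iteratedDeriv j Real.cos 0) +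
        q * ((2 ^ j - 1) * iteratedDeriv j Real.sin 0))) * (x * θ) ^ (k + 1 - j) =
      θ ^ (k + 1) * (
        p₀ * (((k + 1).choose j : ℝ) * x ^ (k + 1 - j) *
          ((0 ^ j + 3 ^ j) * iteratedDeriv j Real.cos 0)) +
        p * (((k + 1).choose j : ℝ) * x ^ (k + 1 - j) *
          ((2 ^ j + 1) * iteratedDeriv j Real.cos 0)) +
        q * (((k + 1).choose j : ℝ) * x ^ (k + 1 - j) *
          ((2 ^ j - 1) * iteratedDeriv j Real.sin 0))) := fun j hj => by
    have hj' : j ≤ k + 1 := Nat.lt_succ_iff.1 (Finset.mem_range.1 hj)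
    rw [mul_pow, ← pow_mul_pow_sub θ hj']
    ring
  simp only [iteratedDeriv_trig_zero, iteratedDeriv_const_rpow_zero hc]
  rw [hl, Finset.sum_congr rfl hsum, ← Finset.mul_sum, Finset.sum_add_distrib,
    Finset.sum_add_distrib, ← Finset.mul_sum, ← Finset.mul_sum, ← Finset.mul_sum]
  linear_combination -θ ^ (k + 1) * (-p₀ * eval_GY k x + 2 * p * eval_GR k x - 2 * q * eval_GS k x)

/-- A combination of two families in the arguments `log a / θ`, `log b / θ`, with `θ = 2π/3`,
as in the value of the principal value integral. -/
noncomputable def pvCombination (R S Y : ℕ → Polynomial ℝ) (a b : ℝ) (k : ℕ) : ℝ :=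
  (2 * Real.pi / 3) ^ (k + 1) / (3 * (a ^ 2 + a * b + b ^ 2)) *
      (-(R k).eval (Real.log a / (2 * Real.pi / 3))
        + 3 * (R k).eval (Real.log b / (2 * Real.pi / 3))
        + (Y k).eval (Real.log a / (2 * Real.pi / 3)))
    + (2 * Real.pi / 3) ^ (k + 1) * (a + b) / (Real.sqrt 3 * (a ^ 3 - b ^ 3)) *
      ((S k).eval (Real.log a / (2 * Real.pi / 3))
        - (S k).eval (Real.log b / (2 * Real.pi / 3)))

lemma contDiff_mellinNum {a b : ℝ} (ha : 0 < a) (hb : 0 < b) (n : ℕ) :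
    ContDiff ℝ n (mellinNum a b) := by
  have h1 : ContDiff ℝ n (fun s : ℝ => a ^ s) := contDiff_const_rpow ha
  have h2 : ContDiff ℝ n (fun s : ℝ => b ^ s) := contDiff_const_rpow hb
  unfold mellinNum
  fun_prop

lemma iteratedDeriv_mellinNum_zero {a b : ℝ} (ha : 0 < a) (hb : 0 < b) (k : ℕ) :
    iteratedDeriv (k + 1) (mellinNum a b) 0 =
      2 * Real.pi * (k + 1) * pvCombination GR GS GY a b k := by
  have hθ : 2 * Real.pi / 3 ≠ 0 := by positivity
  have h1 : ContDiff ℝ (k + 1 : ℕ) (fun s : ℝ => a ^ s) := contDiff_const_rpow ha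
  have h2 : ContDiff ℝ (k + 1 : ℕ) (fun s : ℝ => b ^ s) := contDiff_const_rpow hb
  have e : mellinNum a b = fun s =>
      (-3 * (2 * Real.pi / 3 / (3 * (a ^ 2 + a * b + b ^ 2))) *
          (1 + Real.cos (3 * (2 * Real.pi / 3) * s)) +
        -(3 / 2) * (2 * Real.pi / 3 / (3 * (a ^ 2 + a * b + b ^ 2))) *
          (Real.cos (2 * (2 * Real.pi / 3) * s) + Real.cos (2 * Real.pi / 3 * s)) +
        -(2 * Real.pi / 3 * (a + b) / (Real.sqrt 3 * (a ^ 3 - b ^ 3)) * (3 / 2)) *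
          (Real.sin (2 * (2 * Real.pi / 3) * s) - Real.sin (2 * Real.pi / 3 * s))) * a ^ s +
      (0 * (1 + Real.cos (3 * (2 * Real.pi / 3) * s)) +
        9 / 2 * (2 * Real.pi / 3 / (3 * (a ^ 2 + a * b + b ^ 2))) *
          (Real.cos (2 * (2 * Real.pi / 3) * s) + Real.cos (2 * Real.pi / 3 * s)) +
        2 * Real.pi / 3 * (a + b) / (Real.sqrt 3 * (a ^ 3 - b ^ 3)) * (3 / 2) *
          (Real.sin (2 * (2 * Real.pi / 3) * s) - Real.sin (2 * Real.pi / 3 * s))) * b ^ s := by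
    funext s
    rw [mellinNum]
    ring
  rw [e, iteratedDeriv_fun_add (by fun_prop) (by fun_prop),
    iteratedDeriv_trig_mul_rpow_zero ha hθ, iteratedDeriv_trig_mul_rpow_zero hb hθ, pvCombination]
  ring

lemma sum_choose_mul_pvMoment {a b : ℝ} (ha : 0 < a) (hb : 0 < b) (hab : a ≠ b) (k : ℕ) :
    ∑ j ∈ range (k + 2), ((k + 1).choose j : ℝ) * iteratedDeriv j Real.sin 0 *
      (2 * Real.pi) ^ j * pvMoment a b (k + 1 - j) =
      2 * Real.pi * (k + 1) * pvCombination GR GS GY a b k := by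
  have hm := contDiffAt_regMellin ha hb (k + 1)
  have hmo := contDiffOn_regMellin ha hb (k + 1)
  have hr : ContDiff ℝ (k + 1 : ℕ) (fun s : ℝ => a ^ s) := contDiff_const_rpow ha
  have hn := contDiff_mellinNum ha hb (k + 1)
  have hsin : ContDiff ℝ (k + 1 : ℕ) (fun s => Real.sin (2 * Real.pi * s)) := by fun_prop
  have hA : ContDiffAt ℝ (k + 1 : ℕ) (fun s => a ^ s * regMellin a b s) 0 :=
    hr.contDiffAt.mul hm
  have h0 : iteratedDeriv (k + 1) (fun s =>
      Real.sin (2 * Real.pi * s) * (a ^ s * regMellin a b s) - mellinNum a b s) 0 = 0 :=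
    iteratedDeriv_zero_of_eq_zero_left
      ((hsin.contDiffOn.mul (hr.contDiffOn.mul hmo)).sub hn.contDiffOn)
      fun s h1 h2 => sub_eq_zero.2 (sin_mul_regMellin ha hb hab h1 h2)
  rw [iteratedDeriv_fun_sub (hsin.contDiffAt.mul hA) hn.contDiffAt, sub_eq_zero,
    iteratedDeriv_mellinNum_zero ha hb, iteratedDeriv_fun_mul hsin.contDiffAt hA] at h0
  rw [← h0]
  refine Finset.sum_congr rfl fun j _ => ?_
  rw [iteratedDeriv_comp_const_mul Real.contDiff_sin, pvMoment]
  simp only [mul_zero]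
  ring

lemma sum_choose_mul_pvCombination (a b : ℝ) (k : ℕ) :
    ∑ j ∈ range (k + 2), ((k + 1).choose j : ℝ) * iteratedDeriv j Real.sin 0 *
      (2 * Real.pi) ^ j * pvCombination Rpoly Spoly Ypoly a b (k + 1 - j) =
      2 * Real.pi * (k + 1) * pvCombination GR GS GY a b k := by
  have key : ∀ j ∈ range (k + 2), ((k + 1).choose j : ℝ) * iteratedDeriv j Real.sin 0 *
      (2 * Real.pi) ^ j * pvCombination Rpoly Spoly Ypoly a b (k + 1 - j) =
      (2 * Real.pi / 3) ^ (k + 2) / (3 * (a ^ 2 + a * b + b ^ 2)) *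
      (-(((k + 1).choose j : ℝ) * iteratedDeriv j Real.sin 0 * 3 ^ j *
          (Rpoly (k + 1 - j)).eval (Real.log a / (2 * Real.pi / 3)))
        + 3 * (((k + 1).choose j : ℝ) * iteratedDeriv j Real.sin 0 * 3 ^ j *
          (Rpoly (k + 1 - j)).eval (Real.log b / (2 * Real.pi / 3)))
        + ((k + 1).choose j : ℝ) * iteratedDeriv j Real.sin 0 * 3 ^ j *
          (Ypoly (k + 1 - j)).eval (Real.log a / (2 * Real.pi / 3)))
    + (2 * Real.pi / 3) ^ (k + 2) * (a + b) / (Real.sqrt 3 * (a ^ 3 - b ^ 3)) *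
      (((k + 1).choose j : ℝ) * iteratedDeriv j Real.sin 0 * 3 ^ j *
          (Spoly (k + 1 - j)).eval (Real.log a / (2 * Real.pi / 3))
        - ((k + 1).choose j : ℝ) * iteratedDeriv j Real.sin 0 * 3 ^ j *
          (Spoly (k + 1 - j)).eval (Real.log b / (2 * Real.pi / 3))) := fun j hj => by
    have hj' : j ≤ k + 1 := Nat.lt_succ_iff.1 (Finset.mem_range.1 hj)
    have e1 : (2 * Real.pi) ^ j = 3 ^ j * (2 * Real.pi / 3) ^ j := by
      rw [← mul_pow]; congr 1; ring
    have e2 : (2 * Real.pi / 3) ^ (k + 2) =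
        (2 * Real.pi / 3) ^ j * (2 * Real.pi / 3) ^ (k + 1 - j + 1) := by
      rw [← pow_add]; congr 1; omega
    rw [pvCombination, e1, e2]
    ring
  rw [Finset.sum_congr rfl key, Finset.sum_add_distrib, ← Finset.mul_sum, ← Finset.mul_sum,
    Finset.sum_add_distrib, Finset.sum_add_distrib, Finset.sum_neg_distrib, ← Finset.mul_sum,
    Finset.sum_sub_distrib]
  simp only [Rpoly, Spoly, Ypoly, sum_choose_mul_recFam, pvCombination]
  ring

lemma pvMoment_eq {a b : ℝ} (ha : 0 < a) (hb : 0 < b) (hab : a ≠ b) (k : ℕ) :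
    pvMoment a b k = pvCombination Rpoly Spoly Ypoly a b k :=
  eq_of_sum_choose_mul_sin Real.two_pi_pos.ne' (fun n =>
    (sum_choose_mul_pvMoment ha hb hab n).trans (sum_choose_mul_pvCombination a b n).symm) k

/-- The Cauchy principal value
`g₁(k) = p.v. ∫₀^∞ t(t+a) logᵏt /((t³−a³)(t²+bt+b²)) dt` (pole at `t = a`), in terms
of the recursive polynomials `R_k`, `S_k`, `Y_k`, with `θ = 2π/3`. -/
theorem g1_eval (a b : ℝ) (ha : 0 < a) (hb : 0 < b) (hab : a ≠ b) (k : ℕ) :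
    Filter.Tendsto (fun ε : ℝ =>
        (∫ t in Set.Ioo (0 : ℝ) (a - ε),
            t * (t + a) * Real.log t ^ k / ((t ^ 3 - a ^ 3) * (t ^ 2 + b * t + b ^ 2)))
        + ∫ t in Set.Ioi (a + ε),
            t * (t + a) * Real.log t ^ k / ((t ^ 3 - a ^ 3) * (t ^ 2 + b * t + b ^ 2)))
      (nhdsWithin 0 (Set.Ioi 0))
      (nhds ((2 * Real.pi / 3) ^ (k + 1) / (3 * (a ^ 2 + a * b + b ^ 2)) *
          (-(Rpoly k).eval (Real.log a / (2 * Real.pi / 3))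
            + 3 * (Rpoly k).eval (Real.log b / (2 * Real.pi / 3))
            + (Ypoly k).eval (Real.log a / (2 * Real.pi / 3)))
        + (2 * Real.pi / 3) ^ (k + 1) * (a + b) / (Real.sqrt 3 * (a ^ 3 - b ^ 3)) *
          ((Spoly k).eval (Real.log a / (2 * Real.pi / 3))
            - (Spoly k).eval (Real.log b / (2 * Real.pi / 3))))) := by
  have hf : ∀ t : ℝ, t * (t + a) * Real.log t ^ k / ((t ^ 3 - a ^ 3) * (t ^ 2 + b * t + b ^ 2)) =
      Real.log t ^ k * ratFun a b t := fun t => by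
    rw [ratFun]; ring
  simp only [hf]
  have h := tendsto_pv_log_pow_mul_ratFun ha hb hab k
  rwa [pvMoment_eq ha hb hab, pvCombination] at h
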